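/- arXiv:math/0610193 — 2 statements merged into one kernel-verified Lean document; each statement's English description precedes it below -/
import Mathlib

section
/- Let n ≥ 9 be an odd integer, let k be an integer with 1 ≤ k ≤ (n-1)/2, let f ∈ P_k, and let y ∈ X. Then f(y) ≥ -n/k + 1 - n(k-1)/(k(n² - nk - 4n + 4 + 2k)). -/
open Finset
noncomputable section
open scoped Classical

/-- Index type for the coordinates of `ℝ^{n(n-1)/2}`: unordered pairs of distinct
vertices of the complete graph `K_n` on `Fin n`. -/
abbrev EdgeIdx (n : ℕ) := {e : Sym2 (Fin n) // ¬ e.IsDiag}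

/-- The incidence vector of the Hamiltonian cycle of `K_n` determined by a
permutation `σ` of the vertices. -/
def cycleVec (n : ℕ) (σ : Equiv.Perm (Fin n)) : EdgeIdx n → ℝ :=
  fun e => if ∃ i : Fin n, (e : Sym2 (Fin n)) = s(σ i, σ (finRotate n i)) then 1 else 0

/-- `X`, the (finite) set of incidence vectors of Hamiltonian cycles of `K_n`. -/
def hamX (n : ℕ) : Finset (EdgeIdx n → ℝ) := Finset.image (cycleVec n) Finset.univ

/-- A function `f : X → ℝ` belongs to `P_k` iff it is the restriction to `X` of a
linear function `F` on `ℝ^{n(n-1)/2}` with average value `1` on `X` such that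
`(1/|X|) Σ_{x∈X} F(x) h(x)² ≥ 0` for every polynomial `h` of degree at most `k`. -/
def memP (n k : ℕ) (F : (EdgeIdx n → ℝ) →ₗ[ℝ] ℝ) : Prop :=
  ((hamX n).card : ℝ)⁻¹ * ∑ x ∈ hamX n, F x = 1 ∧
  ∀ h : MvPolynomial (EdgeIdx n) ℝ, h.totalDegree ≤ k →
    0 ≤ ((hamX n).card : ℝ)⁻¹ * ∑ x ∈ hamX n, F x * (MvPolynomial.eval x h) ^ 2

lemma sum_powersetCard_ite_half {K k i : ℕ} (hk : 1 ≤ k) (hi : i ∈ Finset.range K) :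
    ∑ J ∈ (Finset.range K).powersetCard k, (if i ∈ J then (1 / 2 : ℝ) else 1) =
      K.choose k * (1 - k / (2 * K)) := by
  have hK : 0 < K := by have := Finset.mem_range.1 hi; omega
  have h1 := Finset.card_filter_powersetCard_subset {i} (Finset.range K) k (by simpa using hi)
    (by simpa using hk)
  simp only [Finset.singleton_subset_iff, Finset.card_range, Finset.card_singleton] at h1
  have h2 : ∀ J : Finset ℕ, (if i ∈ J then (1 / 2 : ℝ) else 1) =
      1 - (1 / 2) * (if i ∈ J then 1 else 0) := fun J => by split_ifs <;> norm_num
  simp_rw [h2]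
  rw [Finset.sum_sub_distrib, ← Finset.mul_sum, Finset.sum_boole]
  have h3 : (K : ℝ) * (K - 1).choose (k - 1) = K.choose k * k := by
    obtain ⟨K, rfl⟩ : ∃ m, K = m + 1 := ⟨K - 1, by omega⟩
    obtain ⟨k, rfl⟩ : ∃ m, k = m + 1 := ⟨k - 1, by omega⟩
    exact_mod_cast Nat.add_one_mul_choose_eq K k
  have hK' : (K : ℝ) ≠ 0 := by positivity
  have h4 : ((K - 1).choose (k - 1) : ℝ) = K.choose k * k / K := by
    field_simp; linarith
  rw [h1, h4]
  simp
  field_simp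

lemma sum_powersetCard_ite_half_mul {K k i j : ℕ} (hk : 1 ≤ k) (hi : i ∈ Finset.range K)
    (hj : j ∈ Finset.range K) (hij : i ≠ j) :
    ∑ J ∈ (Finset.range K).powersetCard k,
        (if i ∈ J then (1 / 2 : ℝ) else 1) * (if j ∈ J then (1 / 2 : ℝ) else 1) =
      K.choose k * (1 - k / K + k * (k - 1) / (4 * K * (K - 1))) := by
  have hK : 1 < K := by
    have := Finset.mem_range.1 hi
    have := Finset.mem_range.1 hj
    omega
  have h2 : ∀ J : Finset ℕ,
      (if i ∈ J then (1 / 2 : ℝ) else 1) * (if j ∈ J then (1 / 2 : ℝ) else 1) =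
      (if i ∈ J then (1 / 2 : ℝ) else 1) + (if j ∈ J then (1 / 2 : ℝ) else 1) - 1 +
      (1 / 4) * (if {i, j} ⊆ J then 1 else 0) := fun J => by
    simp only [Finset.insert_subset_iff, Finset.singleton_subset_iff]
    by_cases h1 : i ∈ J <;> by_cases h2 : j ∈ J <;> (simp [h1, h2]; try norm_num)
  have h3 : ((((Finset.range K).powersetCard k).filter (fun J => {i, j} ⊆ J)).card : ℝ) =
      K.choose k * (k * (k - 1) / (K * (K - 1))) := by
    have hK0 : (K : ℝ) ≠ 0 := by positivity
    have hK1 : (K : ℝ) - 1 ≠ 0 := by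
      have : (1 : ℝ) < K := by exact_mod_cast hK
      linarith
    by_cases hk2 : 2 ≤ k
    · rw [Finset.card_filter_powersetCard_subset {i, j} (Finset.range K) k
        (by simpa [Finset.insert_subset_iff] using ⟨Finset.mem_range.1 hi, Finset.mem_range.1 hj⟩)
        (by rw [Finset.card_pair hij]; exact hk2), Finset.card_pair hij, Finset.card_range]
      obtain ⟨K, rfl⟩ : ∃ m, K = m + 2 := ⟨K - 2, by omega⟩
      obtain ⟨k, rfl⟩ : ∃ m, k = m + 2 := ⟨k - 2, by omega⟩
      have e1 : ((K + 1 + 1 : ℕ) : ℝ) * (K + 1).choose (k + 1) =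
          (K + 2).choose (k + 2) * (k + 2 : ℕ) :=
        by exact_mod_cast Nat.add_one_mul_choose_eq (K + 1) (k + 1)
      have e2 : ((K + 1 : ℕ) : ℝ) * K.choose k = (K + 1).choose (k + 1) * (k + 1 : ℕ) :=
        by exact_mod_cast Nat.add_one_mul_choose_eq K k
      simp only [Nat.add_sub_cancel]
      push_cast at *
      field_simp
      linear_combination ((K : ℝ) + 2) * e2 + ((k : ℝ) + 1) * e1
    · have hk1 : k = 1 := by omega
      subst hk1
      rw [Finset.filter_eq_empty_iff.2]
      · simp
      · intro J hJ h
        have := Finset.card_le_card h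
        rw [Finset.card_pair hij, (Finset.mem_powersetCard.1 hJ).2] at this
        omega
  simp_rw [h2]
  rw [Finset.sum_add_distrib, Finset.sum_sub_distrib, Finset.sum_add_distrib,
    sum_powersetCard_ite_half hk hi, sum_powersetCard_ite_half hk hj, ← Finset.mul_sum,
    Finset.sum_boole, h3]
  simp
  field_simp
  ring

section Orientation

variable {V : Type*}

lemma prod_add_comm_eq_sum_powerset {ι : Type*} [DecidableEq ι] (J : Finset ι) (p q : ι → V)
    (φ : V → V → ℝ) :
    ∏ j ∈ J, (φ (p j) (q j) + φ (q j) (p j)) =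
      ∑ t ∈ J.powerset, ∏ j ∈ J, φ (if j ∈ t then p j else q j) (if j ∈ t then q j else p j) := by
  rw [Finset.prod_add]
  refine Finset.sum_congr rfl fun t ht => ?_
  rw [← Finset.prod_sdiff (Finset.mem_powerset.1 ht), mul_comm]
  congr 1
  · refine Finset.prod_congr rfl fun j hj => ?_
    simp [(Finset.mem_sdiff.1 hj).2]
  · refine Finset.prod_congr rfl fun j hj => ?_
    simp [hj]

lemma orientation_injOn {ι : Type*} [DecidableEq ι] {J : Finset ι} {p q : ι → V}
    (hp : Set.InjOn p J) (hq : Set.InjOn q J) (hpq : ∀ i ∈ J, ∀ j ∈ J, p i ≠ q j) (t : Finset ι) :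
    Set.InjOn (fun j => if j ∈ t then p j else q j) J := by
  intro i hi j hj h
  dsimp only at h
  split_ifs at h
  · exact hp hi hj h
  · exact absurd h (hpq i hi j hj)
  · exact absurd h.symm (hpq j hj i hi)
  · exact hq hi hj h

lemma orientation_disjoint {ι : Type*} [DecidableEq ι] {J : Finset ι} {p q : ι → V}
    (hp : Set.InjOn p J) (hq : Set.InjOn q J) (hpq : ∀ i ∈ J, ∀ j ∈ J, p i ≠ q j) (t : Finset ι) :
    ∀ i ∈ J, ∀ j ∈ J,
    (if i ∈ t then p i else q i) ≠ (if j ∈ t then q j else p j) := by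
  intro i hi j hj h
  split_ifs at h with h1 h2 h2
  · exact hpq i hi j hj h
  · exact h2 (hp hi hj h ▸ h1)
  · exact h1 (hq hi hj h ▸ h2)
  · exact hpq j hj i hi h.symm

/-- The first vertex of the `j`-th edge of the near-perfect matching of the cycle `ρ` which
misses the vertex `z`. -/
def edgeFst (ρ : Equiv.Perm V) (z : V) (j : ℕ) : V := (ρ ^ (2 * j + 1)) z

/-- The second vertex of the `j`-th edge of the near-perfect matching of the cycle `ρ` which
misses the vertex `z`. -/
def edgeSnd (ρ : Equiv.Perm V) (z : V) (j : ℕ) : V := (ρ ^ (2 * j + 2)) z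

lemma apply_edgeFst (ρ : Equiv.Perm V) (z : V) (j : ℕ) : ρ (edgeFst ρ z j) = edgeSnd ρ z j := by
  rw [edgeFst, edgeSnd, pow_succ' ρ (2 * j + 1), Equiv.Perm.mul_apply]

variable [DecidableEq V]

/-- Indicator of the arc `a → b` in the permutation `c`. -/
def arcInd (c : Equiv.Perm V) (a b : V) : ℝ := if c a = b then 1 else 0

lemma arcInd_conj (ρ c : Equiv.Perm V) (a b : V) :
    arcInd (ρ * c * ρ⁻¹) (ρ a) (ρ b) = arcInd c a b := by
  simp [arcInd]

/-- The product over `j ∈ J` of the indicators that `c` uses, in either direction, the `j`-th edge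
of the near-perfect matching of `ρ` which misses `z`. -/
def matchingInd (ρ : Equiv.Perm V) (z : V) (J : Finset ℕ) (c : Equiv.Perm V) : ℝ :=
  ∏ j ∈ J, (arcInd c (edgeFst ρ z j) (edgeSnd ρ z j) + arcInd c (edgeSnd ρ z j) (edgeFst ρ z j))

lemma prod_edge_ite {ρ : Equiv.Perm V} {K : ℕ} {z a : V} {J : Finset ℕ} (hJ : J ⊆ Finset.range K)
    {i : ℕ} (hi : ∀ j ∈ Finset.range K, (a = edgeFst ρ z j ∨ a = edgeSnd ρ z j) ↔ j = i) :
    (∏ j ∈ J, if a = edgeFst ρ z j ∨ a = edgeSnd ρ z j then (1 / 2 : ℝ) else 1) =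
      if i ∈ J then 1 / 2 else 1 := by
  rw [← Finset.prod_ite_eq' J i (fun _ => (1 / 2 : ℝ))]
  refine Finset.prod_congr rfl fun j hj => ?_
  simp only [hi j (hJ hj)]

end Orientation

section Cyclic

variable {V : Type*}

/-- `c` permutes the elements of `S` in a single cycle and fixes everything outside `S`. -/
def IsCyclicOn (S : Finset V) (c : Equiv.Perm V) : Prop :=
  (∀ x ∉ S, c x = x) ∧ ∀ T ⊆ S, T.Nonempty → (∀ x ∈ T, c x ∈ T) → T = S

lemma IsCyclicOn.apply_mem {S : Finset V} {c : Equiv.Perm V} (hc : IsCyclicOn S c) {x : V}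
    (hx : x ∈ S) : c x ∈ S := by
  by_contra h
  have := hc.1 _ h
  rw [c.injective this] at h
  exact h hx

lemma IsCyclicOn.apply_ne {S : Finset V} {c : Equiv.Perm V} (hc : IsCyclicOn S c) {u w : V}
    (hu : u ∈ S) (hw : w ∈ S) (huw : u ≠ w) : c u ≠ u := by
  intro h
  have := hc.2 {u} (by simpa using hu) (by simp) (by simpa using h)
  rw [← this] at hw
  exact huw (Finset.mem_singleton.1 hw).symm

variable [DecidableEq V]

lemma IsCyclicOn.mul_swap {S : Finset V} {c : Equiv.Perm V} (hc : IsCyclicOn S c) {u w : V}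
    (hu : u ∈ S) (huw : u ≠ w) (h : c u = w) :
    IsCyclicOn (S.erase w) (c * Equiv.swap u w) := by
  have hw : w ∈ S := h ▸ hc.apply_mem hu
  have hcu : (c * Equiv.swap u w) u = c w := by simp
  have hcx : ∀ x, x ≠ u → x ≠ w → (c * Equiv.swap u w) x = c x := fun x h1 h2 => by
    simp [Equiv.swap_apply_of_ne_of_ne h1 h2]
  refine ⟨fun x hx => ?_, fun T hT hne hinv => ?_⟩
  · by_cases hxw : x = w
    · subst hxw; simp [h]
    · have hxS : x ∉ S := fun h' => hx (Finset.mem_erase.2 ⟨hxw, h'⟩)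
      rw [hcx x (fun h' => hxS (h' ▸ hu)) hxw, hc.1 x hxS]
  · have hTS : T ⊆ S := hT.trans (Finset.erase_subset _ _)
    have hwT : w ∉ T := fun h' => by simpa using hT h'
    by_cases huT : u ∈ T
    · have := hc.2 (insert w T) (Finset.insert_subset hw hTS) (by simp) (by
        intro x hx
        rcases Finset.mem_insert.1 hx with rfl | hx
        · exact Finset.mem_insert_of_mem (hcu ▸ hinv u huT)
        · by_cases hxu : x = u
          · subst hxu; simp [h]
          · have := hinv x hx
            rw [hcx x hxu (fun h' => hwT (h' ▸ hx))] at this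
            exact Finset.mem_insert_of_mem this)
      rw [← this, Finset.erase_insert hwT]
    · have := hc.2 T hTS hne (by
        intro x hx
        have h3 := hinv x hx
        rwa [hcx x (fun h' => huT (h' ▸ hx)) (fun h' => hwT (h' ▸ hx))] at h3)
      exact absurd (this ▸ hw) hwT

lemma IsCyclicOn.of_mul_swap {S : Finset V} {c : Equiv.Perm V} {u w : V}
    (hu : u ∈ S) (hw : w ∈ S) (huw : u ≠ w)
    (hc : IsCyclicOn (S.erase w) (c * Equiv.swap u w)) :
    c u = w ∧ IsCyclicOn S c := by
  have hcuw : c u = w := by simpa using hc.1 w (by simp)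
  have hcu : (c * Equiv.swap u w) u = c w := by simp
  have hcx : ∀ x, x ≠ u → x ≠ w → (c * Equiv.swap u w) x = c x := fun x h1 h2 => by
    simp [Equiv.swap_apply_of_ne_of_ne h1 h2]
  have hcw : c w ≠ w := fun h => huw (c.injective (hcuw.trans h.symm))
  refine ⟨hcuw, fun x hx => ?_, fun T hT hne hinv => ?_⟩
  · rw [← hcx x (fun h => hx (h ▸ hu)) (fun h => hx (h ▸ hw))]
    exact hc.1 x (fun h => hx (Finset.mem_of_mem_erase h))
  · have hne' : (T.erase w).Nonempty := by
      obtain ⟨x, hx⟩ := hne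
      by_cases hxw : x = w
      · subst hxw
        exact ⟨c x, Finset.mem_erase.2 ⟨hcw, hinv x hx⟩⟩
      · exact ⟨x, Finset.mem_erase.2 ⟨hxw, hx⟩⟩
    have h1 := hc.2 (T.erase w) (Finset.erase_subset_erase _ hT) hne' (by
      intro x hx
      obtain ⟨hxw, hxT⟩ := Finset.mem_erase.1 hx
      by_cases hxu : x = u
      · subst hxu
        rw [hcu]
        exact Finset.mem_erase.2 ⟨hcw, hinv w (hcuw ▸ hinv x hxT)⟩
      · rw [hcx x hxu hxw]
        exact Finset.mem_erase.2
          ⟨fun h => hxu (c.injective (h.trans hcuw.symm)), hinv x hxT⟩)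
    have huT : u ∈ T := Finset.mem_of_mem_erase (h1 ▸ Finset.mem_erase.2 ⟨huw, hu⟩)
    have hwT : w ∈ T := hcuw ▸ hinv u huT
    rw [← Finset.insert_erase hwT, h1, Finset.insert_erase hw]

variable [Fintype V]

lemma IsCyclicOn.conj {c : Equiv.Perm V} (hc : IsCyclicOn Finset.univ c)
    (τ : Equiv.Perm V) : IsCyclicOn Finset.univ (τ * c * τ⁻¹) := by
  refine ⟨fun x hx => absurd (Finset.mem_univ x) hx, fun T _ hne hinv => ?_⟩
  have := hc.2 (Finset.univ.filter fun x => τ x ∈ T) (Finset.subset_univ _) (by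
    obtain ⟨x, hx⟩ := hne
    exact ⟨τ⁻¹ x, by simpa using hx⟩) (by
    intro x hx
    simpa using hinv (τ x) (by simpa using hx))
  ext x
  have hx : τ⁻¹ x ∈ Finset.univ.filter fun x => τ x ∈ T := by rw [this]; simp
  simpa using hx

/-- The set of all permutations which are cyclic on `S`. -/
def cyclicPerms (S : Finset V) : Finset (Equiv.Perm V) :=
  Finset.univ.filter (IsCyclicOn S)

@[simp] lemma mem_cyclicPerms {S : Finset V} {c : Equiv.Perm V} :
    c ∈ cyclicPerms S ↔ IsCyclicOn S c := by simp [cyclicPerms]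

/-- Contracting the arc from `u` to `w`. -/
lemma card_filter_cyclicPerms {S : Finset V} {u w : V} (hu : u ∈ S) (hw : w ∈ S) (huw : u ≠ w)
    (P : Equiv.Perm V → Prop) [DecidablePred P] :
    ((cyclicPerms S).filter (fun c => c u = w ∧ P (c * Equiv.swap u w))).card =
      ((cyclicPerms (S.erase w)).filter P).card := by
  refine Finset.card_bij' (fun c _ => c * Equiv.swap u w) (fun c _ => c * Equiv.swap u w)
    ?_ ?_ ?_ ?_
  · intro c hc
    simp only [Finset.mem_filter, mem_cyclicPerms] at hc ⊢
    exact ⟨hc.1.mul_swap hu huw hc.2.1, hc.2.2⟩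
  · intro c hc
    simp only [Finset.mem_filter, mem_cyclicPerms] at hc ⊢
    have h2 : c * Equiv.swap u w * Equiv.swap u w = c := by simp [mul_assoc]
    have := IsCyclicOn.of_mul_swap (c := c * Equiv.swap u w) hu hw huw (by rw [h2]; exact hc.1)
    exact ⟨this.2, this.1, by rw [h2]; exact hc.2⟩
  · intro c _; simp [mul_assoc]
  · intro c _; simp [mul_assoc]

lemma card_cyclicPerms (S : Finset V) (hS : S.Nonempty) :
    (cyclicPerms S).card = (S.card - 1).factorial := by
  induction hm : S.card generalizing S with
  | zero => simp [Finset.card_eq_zero.1 hm] at hS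
  | succ m ih =>
    obtain ⟨a, ha⟩ := hS
    by_cases hm0 : m = 0
    · subst hm0
      obtain ⟨b, rfl⟩ := Finset.card_eq_one.1 hm
      have : cyclicPerms {b} = {(1 : Equiv.Perm V)} := by
        ext c
        simp only [mem_cyclicPerms, Finset.mem_singleton]
        constructor
        · intro hc
          ext x
          by_cases hx : x ∈ ({b} : Finset V)
          · have h1 := Finset.mem_singleton.1 (hc.apply_mem hx)
            rw [h1, Finset.mem_singleton.1 hx]; rfl
          · exact hc.1 x hx
        · rintro rfl
          refine ⟨by simp, fun T hT hne _ => ?_⟩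
          exact (Finset.subset_singleton_iff.1 hT).resolve_left hne.ne_empty
      simp [this]
    · have hmaps : ∀ c ∈ cyclicPerms S, c a ∈ S.erase a := by
        intro c hc
        rw [mem_cyclicPerms] at hc
        obtain ⟨b, hb, hba⟩ := Finset.exists_mem_ne (s := S) (by omega) a
        exact Finset.mem_erase.2 ⟨hc.apply_ne ha hb hba.symm, hc.apply_mem ha⟩
      rw [Finset.card_eq_sum_card_fiberwise hmaps]
      have : ∀ b ∈ S.erase a, ((cyclicPerms S).filter (fun c => c a = b)).card =
          (m - 1).factorial := by
        intro b hb
        obtain ⟨hba, hbS⟩ := Finset.mem_erase.1 hb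
        have h1 := card_filter_cyclicPerms ha hbS hba.symm (fun _ => True)
        have hcard : (S.erase b).card = m := by rw [Finset.card_erase_of_mem hbS]; omega
        simp only [and_true, Finset.filter_true] at h1
        rw [h1, ih _ ⟨a, Finset.mem_erase.2 ⟨hba.symm, ha⟩⟩ hcard]
      rw [Finset.sum_congr rfl this, Finset.sum_const, Finset.card_erase_of_mem ha, hm]
      simpa using Nat.mul_factorial_pred hm0

/-- The number of cyclic permutations through prescribed disjoint arcs `t j → h j`. -/
lemma card_cyclicPerms_arcs {ι : Type*} [DecidableEq ι] (J : Finset ι) (t h : ι → V)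
    (S : Finset V) (ht : ∀ j ∈ J, t j ∈ S) (hh : ∀ j ∈ J, h j ∈ S)
    (hti : Set.InjOn t J) (hhi : Set.InjOn h J) (hth : ∀ i ∈ J, ∀ j ∈ J, t i ≠ h j)
    (hS : J.card < S.card) :
    ((cyclicPerms S).filter (fun c => ∀ j ∈ J, c (t j) = h j)).card =
      (S.card - J.card - 1).factorial := by
  induction J using Finset.induction_on generalizing S with
  | empty => simpa using card_cyclicPerms S (Finset.card_pos.1 (by simpa using hS))
  | insert i J hi ih =>
    have hiJ := Finset.mem_insert_self i J
    have hJ : ∀ {j}, j ∈ J → j ∈ insert i J := fun hj => Finset.mem_insert_of_mem hj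
    have hne : ∀ j ∈ J, j ≠ i := fun j hj h' => hi (h' ▸ hj)
    have hcard : (S.erase (h i)).card = S.card - 1 := Finset.card_erase_of_mem (hh i hiJ)
    rw [Finset.card_insert_of_notMem hi] at hS ⊢
    have key := ih (S.erase (h i))
      (fun j hj => Finset.mem_erase.2 ⟨hth j (hJ hj) i hiJ, ht j (hJ hj)⟩)
      (fun j hj => Finset.mem_erase.2
        ⟨fun h' => hne j hj (hhi (hJ hj) hiJ h'), hh j (hJ hj)⟩)
      (hti.mono (by simp)) (hhi.mono (by simp))
      (fun i' hi' j hj => hth i' (hJ hi') j (hJ hj)) (by omega)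
    rw [← card_filter_cyclicPerms (ht i hiJ) (hh i hiJ) (hth i hiJ i hiJ), hcard] at key
    rw [show S.card - (J.card + 1) - 1 = S.card - 1 - J.card - 1 by omega, ← key]
    congr 1
    ext c
    simp only [Finset.mem_filter]
    refine and_congr_right fun _ => ?_
    rw [Finset.forall_mem_insert]
    refine and_congr_right fun _ => forall₂_congr fun j hj => ?_
    rw [Equiv.Perm.mul_apply, Equiv.swap_apply_of_ne_of_ne
      (fun h' => hne j hj (hti (hJ hj) hiJ h')) (hth j (hJ hj) i hiJ)]

/-- The number of cyclic permutations through prescribed disjoint arcs `t j → h j` and one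
further compatible arc `a → b`. -/
lemma card_cyclicPerms_arcs_arc {ι : Type*} [DecidableEq ι] (J : Finset ι) (t h : ι → V)
    (S : Finset V) (ht : ∀ j ∈ J, t j ∈ S) (hh : ∀ j ∈ J, h j ∈ S)
    (hti : Set.InjOn t J) (hhi : Set.InjOn h J) (hth : ∀ i ∈ J, ∀ j ∈ J, t i ≠ h j)
    (a b : V) (ha : a ∈ S) (hb : b ∈ S) (hab : a ≠ b) (hat : ∀ j ∈ J, a ≠ t j)
    (hbh : ∀ j ∈ J, b ≠ h j) (hrev : ∀ j ∈ J, ¬ (a = h j ∧ b = t j)) :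
    ((cyclicPerms S).filter (fun c => (∀ j ∈ J, c (t j) = h j) ∧ c a = b)).card =
      (S.card - J.card - 2).factorial := by
  induction J using Finset.induction_on generalizing S a with
  | empty =>
    have h1 := card_filter_cyclicPerms ha hb hab (fun _ => True)
    simp only [and_true, Finset.filter_true] at h1
    simp only [Finset.notMem_empty, false_imp_iff, implies_true, true_and, Finset.card_empty]
    rw [h1, card_cyclicPerms _ ⟨a, Finset.mem_erase.2 ⟨hab, ha⟩⟩, Finset.card_erase_of_mem hb]
    rfl
  | insert i J hi ih =>
    have hiJ := Finset.mem_insert_self i J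
    have hJ : ∀ {j}, j ∈ J → j ∈ insert i J := fun hj => Finset.mem_insert_of_mem hj
    have hne : ∀ j ∈ J, j ≠ i := fun j hj h' => hi (h' ▸ hj)
    have hcard : (S.erase (h i)).card = S.card - 1 := Finset.card_erase_of_mem (hh i hiJ)
    rw [Finset.card_insert_of_notMem hi]
    have key : ∀ a' : V, a' ∈ S.erase (h i) → a' ≠ b → (∀ j ∈ J, a' ≠ t j) →
        (∀ j ∈ J, ¬ (a' = h j ∧ b = t j)) → _ := fun a' h1 h2 h3 h4 =>
      ih (S.erase (h i))
        (fun j hj => Finset.mem_erase.2 ⟨hth j (hJ hj) i hiJ, ht j (hJ hj)⟩)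
        (fun j hj => Finset.mem_erase.2
          ⟨fun h' => hne j hj (hhi (hJ hj) hiJ h'), hh j (hJ hj)⟩)
        (hti.mono (by simp)) (hhi.mono (by simp))
        (fun i' hi' j hj => hth i' (hJ hi') j (hJ hj)) a' h1
        (Finset.mem_erase.2 ⟨hbh i hiJ, hb⟩) h2 h3 (fun j hj => hbh j (hJ hj)) h4
    have main : ∃ a' : V, a' ∈ S.erase (h i) ∧ a' ≠ b ∧ (∀ j ∈ J, a' ≠ t j) ∧
        (∀ j ∈ J, ¬ (a' = h j ∧ b = t j)) ∧ Equiv.swap (t i) (h i) a' = a := by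
      by_cases hai : a = h i
      · refine ⟨t i, Finset.mem_erase.2 ⟨hth i hiJ i hiJ, ht i hiJ⟩,
          fun h' => hrev i hiJ ⟨hai, h'.symm⟩,
          fun j hj h' => hne j hj (hti (hJ hj) hiJ h'.symm),
          fun j hj h' => hth i hiJ j (hJ hj) h'.1, by simp [hai]⟩
      · exact ⟨a, Finset.mem_erase.2 ⟨hai, ha⟩, hab, fun j hj => hat j (hJ hj),
          fun j hj => hrev j (hJ hj), Equiv.swap_apply_of_ne_of_ne (hat i hiJ) hai⟩
    obtain ⟨a', h1, h2, h3, h4, h5⟩ := main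
    have key := key a' h1 h2 h3 h4
    rw [← card_filter_cyclicPerms (ht i hiJ) (hh i hiJ) (hth i hiJ i hiJ), hcard] at key
    rw [show S.card - (J.card + 1) - 2 = S.card - 1 - J.card - 2 by omega, ← key]
    congr 1
    ext c
    simp only [Finset.mem_filter]
    refine and_congr_right fun _ => ?_
    rw [Finset.forall_mem_insert, and_assoc, Equiv.Perm.mul_apply, h5]
    refine and_congr_right fun _ => and_congr_left fun _ => forall₂_congr fun j hj => ?_
    rw [Equiv.Perm.mul_apply, Equiv.swap_apply_of_ne_of_ne
      (fun h' => hne j hj (hti (hJ hj) hiJ h')) (hth j (hJ hj) i hiJ)]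

lemma isCyclicOn_univ_iff {c : Equiv.Perm V} :
    IsCyclicOn Finset.univ c ↔ c.IsCycleOn ((Finset.univ : Finset V) : Set V) := by
  rw [Finset.coe_univ]
  constructor
  · intro hc
    refine ⟨Set.bijOn_univ.2 c.bijective, fun x _ y _ => ?_⟩
    have := hc.2 (Finset.univ.filter (c.SameCycle x)) (Finset.subset_univ _)
      ⟨x, by simp [Equiv.Perm.SameCycle.refl]⟩
      (by intro y hy; simpa using hy)
    simpa using this.ge (Finset.mem_univ y)
  · intro hc
    refine ⟨fun x hx => absurd (Finset.mem_univ x) hx, fun T _ hne hinv => ?_⟩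
    obtain ⟨x, hx⟩ := hne
    refine Finset.eq_univ_iff_forall.2 fun y => ?_
    obtain ⟨m, rfl⟩ := hc.exists_pow_eq' Set.finite_univ (Set.mem_univ x) (Set.mem_univ y)
    clear hc
    induction m with
    | zero => simpa using hx
    | succ m ih => rw [pow_succ', Equiv.Perm.mul_apply]; exact hinv _ ih

lemma sum_prod_arcInd {ι : Type*} [DecidableEq ι] {J : Finset ι} {p q : ι → V}
    (hp : Set.InjOn p J) (hq : Set.InjOn q J) (hpq : ∀ i ∈ J, ∀ j ∈ J, p i ≠ q j)
    (hJ : J.card < Fintype.card V) :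
    ∑ c ∈ cyclicPerms (Finset.univ : Finset V),
        ∏ j ∈ J, (arcInd c (p j) (q j) + arcInd c (q j) (p j)) =
      2 ^ J.card * ((Fintype.card V - J.card - 1).factorial : ℝ) := by
  simp_rw [prod_add_comm_eq_sum_powerset]
  rw [Finset.sum_comm]
  have : ∀ t ∈ J.powerset, ∑ c ∈ cyclicPerms (Finset.univ : Finset V),
      ∏ j ∈ J, arcInd c (if j ∈ t then p j else q j) (if j ∈ t then q j else p j) =
      ((Fintype.card V - J.card - 1).factorial : ℝ) := by
    intro t _
    have key := card_cyclicPerms_arcs J (fun j => if j ∈ t then p j else q j)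
      (fun j => if j ∈ t then q j else p j) Finset.univ (by simp) (by simp)
      (orientation_injOn hp hq hpq t)
      (orientation_injOn hq hp (fun i hi j hj h => hpq j hj i hi h.symm) t)
      (orientation_disjoint hp hq hpq t) (by simpa using hJ)
    rw [Finset.card_univ] at key
    rw [← key]
    simp_rw [arcInd, Finset.prod_boole]
    rw [Finset.sum_boole]
    norm_cast
    congr
  rw [Finset.sum_congr rfl this, Finset.sum_const, Finset.card_powerset]
  simp

lemma sum_prod_arcInd_mul {ι : Type*} [DecidableEq ι] {J : Finset ι} {p q : ι → V}
    (hp : Set.InjOn p J) (hq : Set.InjOn q J) (hpq : ∀ i ∈ J, ∀ j ∈ J, p i ≠ q j)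
    {a b : V} (hab : a ≠ b)
    (hJ : ∀ j ∈ J, ¬ (a = p j ∧ b = q j) ∧ ¬ (a = q j ∧ b = p j)) :
    ∑ c ∈ cyclicPerms (Finset.univ : Finset V),
        (∏ j ∈ J, (arcInd c (p j) (q j) + arcInd c (q j) (p j))) * arcInd c a b =
      ((Fintype.card V - J.card - 2).factorial : ℝ) *
        ∏ j ∈ J, ((if a ≠ p j ∧ b ≠ q j then (1 : ℝ) else 0) +
          (if a ≠ q j ∧ b ≠ p j then (1 : ℝ) else 0)) := by
  simp_rw [prod_add_comm_eq_sum_powerset J p q (arcInd _)]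
  rw [prod_add_comm_eq_sum_powerset J p q (fun x y => if a ≠ x ∧ b ≠ y then (1 : ℝ) else 0)]
  simp_rw [Finset.sum_mul]
  rw [Finset.sum_comm, Finset.mul_sum]
  refine Finset.sum_congr rfl fun t _ => ?_
  simp_rw [arcInd, Finset.prod_boole, ite_mul, one_mul, zero_mul, ← ite_and]
  rw [Finset.sum_boole]
  split_ifs with h
  · rw [mul_one]
    have key := card_cyclicPerms_arcs_arc J (fun j => if j ∈ t then p j else q j)
      (fun j => if j ∈ t then q j else p j) Finset.univ (by simp) (by simp)
      (orientation_injOn hp hq hpq t)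
      (orientation_injOn hq hp (fun i hi j hj h => hpq j hj i hi h.symm) t)
      (orientation_disjoint hp hq hpq t) a b (by simp) (by simp) hab
      (fun j hj => (h j hj).1) (fun j hj => (h j hj).2)
      (fun j hj h' => by
        split_ifs at h'
        · exact (hJ j hj).2 h'
        · exact (hJ j hj).1 h')
    rw [Finset.card_univ] at key
    rw [← key]
    norm_cast
    congr
  · rw [mul_zero, Nat.cast_eq_zero, Finset.card_eq_zero, Finset.filter_eq_empty_iff]
    rintro c - ⟨h1, h2⟩
    refine h fun j hj => ⟨?_, ?_⟩
    · intro h3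
      refine (hJ j hj).elim ?_
      have h4 := h1 j hj
      rw [← h3, h2] at h4
      intro h5 h6
      split_ifs at h3 h4
      · exact h5 ⟨h3, h4⟩
      · exact h6 ⟨h3, h4⟩
    · intro h3
      refine (hJ j hj).elim ?_
      have h4 := c.injective ((h1 j hj).trans (h3.symm.trans h2.symm))
      intro h5 h6
      split_ifs at h3 h4
      · exact h5 ⟨h4.symm, h3⟩
      · exact h6 ⟨h4.symm, h3⟩

/-- The number of triples consisting of a vertex `z`, a set of `k` edges of the near-perfect
matching of `ρ` missing `z`, and a cyclic permutation using these edges and the arc `a → b`. -/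
def arcCount (ρ : Equiv.Perm V) (K k : ℕ) (a b : V) : ℝ :=
  ∑ z : V, ∑ J ∈ (Finset.range K).powersetCard k,
    ∑ c ∈ cyclicPerms (Finset.univ : Finset V), matchingInd ρ z J c * arcInd c a b

lemma sum_cyclicPerms_conj (ρ : Equiv.Perm V) (g : Equiv.Perm V → ℝ) :
    ∑ c ∈ cyclicPerms (Finset.univ : Finset V), g (ρ * c * ρ⁻¹) =
      ∑ c ∈ cyclicPerms (Finset.univ : Finset V), g c := by
  refine Finset.sum_bij' (fun c _ => ρ * c * ρ⁻¹) (fun c _ => ρ⁻¹ * c * ρ) ?_ ?_ ?_ ?_ ?_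
  · intro c hc
    exact mem_cyclicPerms.2 ((mem_cyclicPerms.1 hc).conj ρ)
  · intro c hc
    simpa using (mem_cyclicPerms.1 hc).conj ρ⁻¹
  · intro c _; group
  · intro c _; group
  · intro c _; rfl

lemma arcCount_apply (ρ : Equiv.Perm V) (K k : ℕ) (a b : V) :
    arcCount ρ K k (ρ a) (ρ b) = arcCount ρ K k a b := by
  unfold arcCount
  rw [← Equiv.sum_comp ρ]
  refine Finset.sum_congr rfl fun z _ => Finset.sum_congr rfl fun J _ => ?_
  rw [← sum_cyclicPerms_conj ρ]
  have h1 : ∀ m : ℕ, (ρ ^ m) (ρ z) = ρ ((ρ ^ m) z) := fun m => by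
    rw [← Equiv.Perm.mul_apply, ← Equiv.Perm.mul_apply, ← pow_succ, ← pow_succ']
  simp only [matchingInd, edgeFst, edgeSnd, h1, arcInd_conj]

section NearPerfectMatching

variable {ρ : Equiv.Perm V} {K : ℕ}

lemma pow_apply_eq_iff (hρ : IsCyclicOn Finset.univ ρ) (hK : Fintype.card V = 2 * K + 1) {z : V}
    {r s : ℕ} (hr : r ≤ 2 * K) (hs : s ≤ 2 * K) : (ρ ^ r) z = (ρ ^ s) z ↔ r = s := by
  rw [(isCyclicOn_univ_iff.1 hρ).pow_apply_eq_pow_apply (Finset.mem_univ z), Finset.card_univ, hK]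
  exact ⟨fun h => Nat.ModEq.eq_of_lt_of_lt h (by omega) (by omega), fun h => h ▸ rfl⟩

lemma edgeFst_injOn (hρ : IsCyclicOn Finset.univ ρ) (hK : Fintype.card V = 2 * K + 1) (z : V) :
    Set.InjOn (edgeFst ρ z) (Finset.range K) := by
  intro i hi j hj h
  simp only [Finset.coe_range, Set.mem_Iio] at hi hj
  have := (pow_apply_eq_iff hρ hK (by omega) (by omega)).1 h
  omega

lemma edgeSnd_injOn (hρ : IsCyclicOn Finset.univ ρ) (hK : Fintype.card V = 2 * K + 1) (z : V) :
    Set.InjOn (edgeSnd ρ z) (Finset.range K) := by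
  intro i hi j hj h
  simp only [Finset.coe_range, Set.mem_Iio] at hi hj
  have := (pow_apply_eq_iff hρ hK (by omega) (by omega)).1 h
  omega

lemma edgeFst_ne_edgeSnd (hρ : IsCyclicOn Finset.univ ρ) (hK : Fintype.card V = 2 * K + 1) (z : V)
    {i j : ℕ} (hi : i ∈ Finset.range K) (hj : j ∈ Finset.range K) :
    edgeFst ρ z i ≠ edgeSnd ρ z j := by
  intro h
  rw [Finset.mem_range] at hi hj
  have := (pow_apply_eq_iff hρ hK (by omega) (by omega)).1 h
  omega

lemma exists_edge_iff (hρ : IsCyclicOn Finset.univ ρ) (hK : Fintype.card V = 2 * K + 1) {a z : V}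
    (haz : a ≠ z) : ∃ i ∈ Finset.range K, ∀ j ∈ Finset.range K,
      (a = edgeFst ρ z j ∨ a = edgeSnd ρ z j) ↔ j = i := by
  obtain ⟨r, hr, rfl⟩ := (isCyclicOn_univ_iff.1 hρ).exists_pow_eq (Finset.mem_univ z)
    (Finset.mem_univ a)
  rw [Finset.card_univ, hK] at hr
  have hr0 : r ≠ 0 := by rintro rfl; simp at haz
  refine ⟨(r - 1) / 2, Finset.mem_range.2 (by omega), fun j hj => ?_⟩
  rw [Finset.mem_range] at hj
  rw [edgeFst, edgeSnd, pow_apply_eq_iff hρ hK (by omega) (by omega),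
    pow_apply_eq_iff hρ hK (by omega) (by omega)]
  omega

lemma ne_edge (hρ : IsCyclicOn Finset.univ ρ) (hK : Fintype.card V = 2 * K + 1) (z : V) {j : ℕ}
    (hj : j ∈ Finset.range K) : ¬ (z = edgeFst ρ z j ∨ z = edgeSnd ρ z j) := by
  rw [Finset.mem_range] at hj
  have h1 := pow_apply_eq_iff hρ hK (z := z) (r := 0) (s := 2 * j + 1) (by omega) (by omega)
  have h2 := pow_apply_eq_iff hρ hK (z := z) (r := 0) (s := 2 * j + 2) (by omega) (by omega)
  rw [pow_zero, Equiv.Perm.one_apply] at h1 h2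
  rw [edgeFst, edgeSnd, h1, h2]
  omega

lemma sum_matchingInd (hρ : IsCyclicOn Finset.univ ρ) (hK : Fintype.card V = 2 * K + 1) (z : V)
    {J : Finset ℕ} (hJ : J ⊆ Finset.range K) :
    ∑ c ∈ cyclicPerms (Finset.univ : Finset V), matchingInd ρ z J c =
      2 ^ J.card * ((2 * K + 1 - J.card - 1).factorial : ℝ) := by
  have hcard := Finset.card_le_card hJ
  rw [Finset.card_range] at hcard
  rw [← hK]
  exact sum_prod_arcInd ((edgeFst_injOn hρ hK z).mono (by exact_mod_cast hJ))
    ((edgeSnd_injOn hρ hK z).mono (by exact_mod_cast hJ))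
    (fun i hi j hj => edgeFst_ne_edgeSnd hρ hK z (hJ hi) (hJ hj)) (by omega)

lemma sum_matchingInd_mul_arcInd (hρ : IsCyclicOn Finset.univ ρ)
    (hK : Fintype.card V = 2 * K + 1) (z : V) {J : Finset ℕ} (hJ : J ⊆ Finset.range K) {a b : V}
    (hab : a ≠ b) (h1 : ρ a ≠ b) (h2 : ρ b ≠ a) :
    ∑ c ∈ cyclicPerms (Finset.univ : Finset V), matchingInd ρ z J c * arcInd c a b =
      ((2 * K + 1 - J.card - 2).factorial : ℝ) * 2 ^ J.card *
        ((∏ j ∈ J, if a = edgeFst ρ z j ∨ a = edgeSnd ρ z j then (1 / 2 : ℝ) else 1) *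
          ∏ j ∈ J, if b = edgeFst ρ z j ∨ b = edgeSnd ρ z j then (1 / 2 : ℝ) else 1) := by
  have hadj : ∀ j, ¬ (a = edgeFst ρ z j ∧ b = edgeSnd ρ z j) ∧
      ¬ (a = edgeSnd ρ z j ∧ b = edgeFst ρ z j) := by
    intro j
    constructor
    · rintro ⟨rfl, rfl⟩; exact h1 (apply_edgeFst ρ z j)
    · rintro ⟨rfl, rfl⟩; exact h2 (apply_edgeFst ρ z j)
  have key := sum_prod_arcInd_mul ((edgeFst_injOn hρ hK z).mono (by exact_mod_cast hJ))
    ((edgeSnd_injOn hρ hK z).mono (by exact_mod_cast hJ))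
    (fun i hi j hj => edgeFst_ne_edgeSnd hρ hK z (hJ hi) (hJ hj)) hab (fun j _ => hadj j)
  rw [hK] at key
  unfold matchingInd
  rw [key, mul_assoc, ← Finset.prod_mul_distrib, ← Finset.prod_const, ← Finset.prod_mul_distrib]
  congr 1
  refine Finset.prod_congr rfl fun j hj => ?_
  have hne := edgeFst_ne_edgeSnd hρ hK z (hJ hj) (hJ hj)
  obtain ⟨h3, h4⟩ := hadj j
  generalize edgeFst ρ z j = x at *
  generalize edgeSnd ρ z j = y at *
  by_cases e1 : a = x <;> by_cases e2 : a = y <;> by_cases e3 : b = x <;> by_cases e4 : b = y <;>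
    simp_all [one_add_one_eq_two]

lemma prod_edge_ite_self (hρ : IsCyclicOn Finset.univ ρ) (hK : Fintype.card V = 2 * K + 1) (z : V)
    {J : Finset ℕ} (hJ : J ⊆ Finset.range K) :
    (∏ j ∈ J, if z = edgeFst ρ z j ∨ z = edgeSnd ρ z j then (1 / 2 : ℝ) else 1) = 1 :=
  Finset.prod_eq_one fun _ hj => if_neg (ne_edge hρ hK z (hJ hj))

lemma arcCount_of_not_adj (hρ : IsCyclicOn Finset.univ ρ) (hK : Fintype.card V = 2 * K + 1)
    {k : ℕ} (hk : 1 ≤ k) {a b : V} (hab : a ≠ b) (h1 : ρ a ≠ b) (h2 : ρ b ≠ a) :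
    arcCount ρ K k a b = ((2 * K + 1 - k - 2).factorial : ℝ) * 2 ^ k * K.choose k *
      (2 * (1 - k / (2 * K)) +
        (2 * K - 1) * (1 - k / K + k * (k - 1) / (4 * K * (K - 1)))) := by
  set A : ℝ := ((2 * K + 1 - k - 2).factorial : ℝ) * 2 ^ k with hA
  have hz : ∀ z : V, ∑ J ∈ (Finset.range K).powersetCard k,
      ∑ c ∈ cyclicPerms (Finset.univ : Finset V), matchingInd ρ z J c * arcInd c a b =
      (A * (K.choose k * (1 - k / K + k * (k - 1) / (4 * K * (K - 1))))) +
      ((if z = a then 1 else 0) + (if z = b then 1 else 0)) *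
        (A * (K.choose k * (1 - k / (2 * K))) -
          A * (K.choose k * (1 - k / K + k * (k - 1) / (4 * K * (K - 1))))) := by
    intro z
    have step : ∑ J ∈ (Finset.range K).powersetCard k,
        ∑ c ∈ cyclicPerms (Finset.univ : Finset V), matchingInd ρ z J c * arcInd c a b =
        ∑ J ∈ (Finset.range K).powersetCard k, A *
        ((∏ j ∈ J, if a = edgeFst ρ z j ∨ a = edgeSnd ρ z j then (1 / 2 : ℝ) else 1) *
          ∏ j ∈ J, if b = edgeFst ρ z j ∨ b = edgeSnd ρ z j then (1 / 2 : ℝ) else 1) := by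
      refine Finset.sum_congr rfl fun J hJ => ?_
      obtain ⟨hJ1, hJ2⟩ := Finset.mem_powersetCard.1 hJ
      rw [sum_matchingInd_mul_arcInd hρ hK z hJ1 hab h1 h2, hJ2]
    rw [step, ← Finset.mul_sum]
    by_cases hza : z = a
    · subst hza
      obtain ⟨i, hi, hi'⟩ := exists_edge_iff hρ hK hab.symm
      rw [if_pos rfl, if_neg hab, ← sum_powersetCard_ite_half hk hi]
      rw [Finset.sum_congr rfl fun J hJ => by
        rw [prod_edge_ite_self hρ hK z (Finset.mem_powersetCard.1 hJ).1,
          prod_edge_ite (Finset.mem_powersetCard.1 hJ).1 hi', one_mul]]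
      ring
    · by_cases hzb : z = b
      · subst hzb
        obtain ⟨i, hi, hi'⟩ := exists_edge_iff hρ hK hab
        rw [if_pos rfl, if_neg hza, ← sum_powersetCard_ite_half hk hi]
        rw [Finset.sum_congr rfl fun J hJ => by
          rw [prod_edge_ite_self hρ hK z (Finset.mem_powersetCard.1 hJ).1,
            prod_edge_ite (Finset.mem_powersetCard.1 hJ).1 hi', mul_one]]
        ring
      · obtain ⟨i, hi, hi'⟩ := exists_edge_iff hρ hK (Ne.symm hza)
        obtain ⟨j, hj, hj'⟩ := exists_edge_iff hρ hK (Ne.symm hzb)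
        have hij : i ≠ j := by
          rintro rfl
          have e1 := (hi' i hi).2 rfl
          have e2 := (hj' i hi).2 rfl
          have e3 := apply_edgeFst ρ z i
          rcases e1 with e1 | e1 <;> rcases e2 with e2 | e2
          · exact hab (e1.trans e2.symm)
          · exact h1 (by rw [e1, e2, e3])
          · exact h2 (by rw [e1, e2, e3])
          · exact hab (e1.trans e2.symm)
        rw [if_neg hza, if_neg hzb, ← sum_powersetCard_ite_half_mul hk hi hj hij]
        rw [Finset.sum_congr rfl fun J hJ => by
          rw [prod_edge_ite (Finset.mem_powersetCard.1 hJ).1 hi',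
            prod_edge_ite (Finset.mem_powersetCard.1 hJ).1 hj']]
        ring
  unfold arcCount
  rw [Finset.sum_congr rfl fun z _ => hz z, Finset.sum_add_distrib, Finset.sum_const,
    ← Finset.sum_mul, Finset.sum_add_distrib, Finset.sum_ite_eq', Finset.sum_ite_eq',
    Finset.card_univ, hK]
  simp only [Finset.mem_univ, if_true, nsmul_eq_mul]
  push_cast
  ring

lemma sum_arcCount (hρ : IsCyclicOn Finset.univ ρ) (hK : Fintype.card V = 2 * K + 1) (k : ℕ)
    (a : V) : ∑ b, arcCount ρ K k a b =
      (2 * K + 1) * K.choose k * (2 ^ k * ((2 * K + 1 - k - 1).factorial : ℝ)) := by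
  have h1 : ∀ c : Equiv.Perm V, ∑ b, arcInd c a b = 1 := fun c => by simp [arcInd]
  unfold arcCount
  rw [Finset.sum_comm]
  have h2 : ∀ z : V, ∑ b, ∑ J ∈ (Finset.range K).powersetCard k,
      ∑ c ∈ cyclicPerms (Finset.univ : Finset V), matchingInd ρ z J c * arcInd c a b =
      K.choose k * (2 ^ k * ((2 * K + 1 - k - 1).factorial : ℝ)) := by
    intro z
    rw [Finset.sum_comm]
    have : ∀ J ∈ (Finset.range K).powersetCard k, ∑ b,
        ∑ c ∈ cyclicPerms (Finset.univ : Finset V), matchingInd ρ z J c * arcInd c a b =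
        2 ^ k * ((2 * K + 1 - k - 1).factorial : ℝ) := by
      intro J hJ
      obtain ⟨hJ1, hJ2⟩ := Finset.mem_powersetCard.1 hJ
      rw [Finset.sum_comm]
      simp_rw [← Finset.mul_sum, h1, mul_one]
      rw [sum_matchingInd hρ hK z hJ1, hJ2]
    rw [Finset.sum_congr rfl this, Finset.sum_const, Finset.card_powersetCard, Finset.card_range,
      nsmul_eq_mul]
  rw [Finset.sum_congr rfl fun z _ => h2 z, Finset.sum_const, Finset.card_univ, hK, nsmul_eq_mul]
  push_cast
  ring

lemma arcCount_add_arcCount_of_adj (hρ : IsCyclicOn Finset.univ ρ)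
    (hK : Fintype.card V = 2 * K + 1) (hK1 : 1 ≤ K) {k : ℕ} {d : ℝ}
    (hd : ∀ a b : V, a ≠ b → ρ a ≠ b → ρ b ≠ a → arcCount ρ K k a b = d) (a : V) :
    arcCount ρ K k a (ρ a) + arcCount ρ K k (ρ a) a =
      (2 * K + 1) * K.choose k * (2 ^ k * ((2 * K + 1 - k - 1).factorial : ℝ)) -
        (2 * K - 2) * d := by
  have hself : ∀ x : V, arcCount ρ K k x x = 0 := by
    intro x
    unfold arcCount
    refine Finset.sum_eq_zero fun z _ => Finset.sum_eq_zero fun J _ =>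
      Finset.sum_eq_zero fun c hc => ?_
    obtain ⟨y, hy⟩ := Fintype.exists_ne_of_one_lt_card (by omega) x
    rw [arcInd, if_neg ((mem_cyclicPerms.1 hc).apply_ne (Finset.mem_univ x) (Finset.mem_univ y)
      hy.symm), mul_zero]
  have hpow : ∀ {r s : ℕ}, r ≤ 2 * K → s ≤ 2 * K → r ≠ s →
      (ρ ^ r) (ρ⁻¹ a) ≠ (ρ ^ s) (ρ⁻¹ a) := fun hr hs hrs h =>
    hrs ((pow_apply_eq_iff hρ hK hr hs).1 h)
  have e1 : ρ⁻¹ a ≠ a := by simpa using hpow (r := 0) (s := 1) (by omega) (by omega) (by omega)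
  have e2 : ρ⁻¹ a ≠ ρ a := by
    simpa [pow_two] using hpow (r := 0) (s := 2) (by omega) (by omega) (by omega)
  have e3 : a ≠ ρ a := by
    simpa [pow_two] using hpow (r := 1) (s := 2) (by omega) (by omega) (by omega)
  have hrot : arcCount ρ K k (ρ a) a = arcCount ρ K k a (ρ⁻¹ a) := by
    rw [← arcCount_apply ρ K k a (ρ⁻¹ a)]
    simp
  have hval : ∀ b, arcCount ρ K k a b = d + (if b = a then -d else 0) +
      (if b = ρ a then arcCount ρ K k a (ρ a) - d else 0) +
      (if b = ρ⁻¹ a then arcCount ρ K k a (ρ⁻¹ a) - d else 0) := by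
    intro b
    by_cases h1 : b = a
    · subst h1
      rw [if_pos rfl, if_neg e3, if_neg e1.symm, hself]; ring
    · by_cases h2 : b = ρ a
      · subst h2
        rw [if_neg h1, if_pos rfl, if_neg e2.symm]; ring
      · by_cases h3 : b = ρ⁻¹ a
        · subst h3
          rw [if_neg h1, if_pos rfl, if_neg h2]; ring
        · rw [if_neg h1, if_neg h2, if_neg h3, hd a b (Ne.symm h1) (Ne.symm h2)
            (fun h => h3 (by rw [← h]; simp))]
          ring
  have hsum := sum_arcCount hρ hK k a
  rw [Finset.sum_congr rfl fun b _ => hval b] at hsum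
  simp only [Finset.sum_add_distrib, Finset.sum_ite_eq', Finset.mem_univ, if_true,
    Finset.sum_const, Finset.card_univ, hK, nsmul_eq_mul] at hsum
  push_cast at hsum
  rw [hrot, ← hsum]
  ring

end NearPerfectMatching

end Cyclic

lemma sum_comp_eq_card_mul_sum_image {G B : Type*} [Group G] [Fintype G] [DecidableEq B]
    (f : G → B) (hf : ∀ τ σ σ', f σ = f σ' → f (τ * σ) = f (τ * σ')) (g : B → ℝ) :
    ∑ σ, g (f σ) = ((Finset.univ.filter fun σ => f σ = f 1).card : ℝ) *
      ∑ b ∈ Finset.univ.image f, g b := by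
  rw [Finset.sum_comp, Finset.mul_sum]
  refine Finset.sum_congr rfl fun b hb => ?_
  obtain ⟨τ, -, rfl⟩ := Finset.mem_image.1 hb
  rw [nsmul_eq_mul]
  congr 2
  refine Finset.card_bij' (fun σ _ => τ⁻¹ * σ) (fun σ _ => τ * σ) ?_ ?_ ?_ ?_
  · intro σ hσ
    simpa using hf τ⁻¹ σ τ (by simpa using hσ)
  · intro σ hσ
    simpa using hf τ σ 1 (by simpa using hσ)
  · intro σ _; simp
  · intro σ _; simp

/-- The incidence vector of the undirected cycle underlying a cyclic permutation. -/
def permVec {n : ℕ} (c : Equiv.Perm (Fin n)) : EdgeIdx n → ℝ :=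
  fun e => if ∃ a, (e : Sym2 (Fin n)) = s(a, c a) then 1 else 0

lemma cycleVec_eq_permVec {n : ℕ} (σ : Equiv.Perm (Fin n)) :
    cycleVec n σ = permVec (σ * finRotate n * σ⁻¹) := by
  funext e
  unfold cycleVec permVec
  congr 1
  refine propext ⟨fun ⟨i, hi⟩ => ⟨σ i, by simpa using hi⟩, fun ⟨a, ha⟩ => ⟨σ⁻¹ a, by simpa using ha⟩⟩

lemma permVec_mk {n : ℕ} (hn : 3 ≤ n) {c : Equiv.Perm (Fin n)} (hc : IsCyclicOn Finset.univ c)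
    {a b : Fin n} (h : ¬ (s(a, b) : Sym2 (Fin n)).IsDiag) :
    permVec c ⟨s(a, b), h⟩ = arcInd c a b + arcInd c b a := by
  have hnot : ¬ (c a = b ∧ c b = a) := by
    rintro ⟨h1, h2⟩
    have h3 := hc.2 {a, b} (Finset.subset_univ _) (by simp) (by simp [h1, h2])
    have h4 := congrArg Finset.card h3
    have h5 := Finset.card_le_two (a := a) (b := b)
    rw [h4, Finset.card_univ, Fintype.card_fin] at h5
    omega
  have hiff : (∃ x, (s(a, b) : Sym2 (Fin n)) = s(x, c x)) ↔ c a = b ∨ c b = a := by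
    constructor
    · rintro ⟨x, hx⟩
      rcases Sym2.eq_iff.1 hx with ⟨rfl, h⟩ | ⟨h, rfl⟩
      · exact Or.inl h.symm
      · exact Or.inr h.symm
    · rintro (h | h)
      · exact ⟨a, by rw [h]⟩
      · exact ⟨b, by rw [h, Sym2.eq_swap]⟩
  unfold permVec arcInd
  simp only [hiff]
  by_cases h1 : c a = b <;> by_cases h2 : c b = a <;> simp_all

lemma isCyclicOn_finRotate {n : ℕ} (hn : 2 ≤ n) : IsCyclicOn Finset.univ (finRotate n) := by
  rw [isCyclicOn_univ_iff]
  have h := (isCycle_finRotate_of_le hn).isCycleOn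
  convert h using 1
  rw [← Equiv.Perm.coe_support_eq_set_support, support_finRotate_of_le hn]

lemma image_conj_finRotate {n : ℕ} (hn : 2 ≤ n) :
    Finset.univ.image (fun σ : Equiv.Perm (Fin n) => σ * finRotate n * σ⁻¹) =
      cyclicPerms Finset.univ := by
  ext c
  simp only [Finset.mem_image, Finset.mem_univ, true_and, mem_cyclicPerms]
  constructor
  · rintro ⟨σ, rfl⟩
    exact (isCyclicOn_finRotate hn).conj σ
  · intro hc
    have hne : ∀ x, c x ≠ x := fun x => by
      obtain ⟨y, hy⟩ := Fintype.exists_ne_of_one_lt_card (by rw [Fintype.card_fin]; omega) x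
      exact hc.apply_ne (Finset.mem_univ x) (Finset.mem_univ y) hy.symm
    have hsupp : c.support = Finset.univ := by ext x; simpa using hne x
    have hcyc : c.IsCycle := by
      refine ⟨⟨0, by omega⟩, hne _, fun y _ => ?_⟩
      exact (isCyclicOn_univ_iff.1 hc).2 (by simp) (by simp)
    exact isConj_iff.1 ((isCycle_finRotate_of_le hn).isConj hcyc
      (by rw [hsupp, support_finRotate_of_le hn]))

lemma permVec_conj {n : ℕ} (τ c : Equiv.Perm (Fin n)) (e : EdgeIdx n) :
    permVec (τ * c * τ⁻¹) e =
      permVec c ⟨Sym2.map (⇑(τ⁻¹)) e, by rw [Sym2.isDiag_map (τ⁻¹).injective]; exact e.2⟩ := by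
  obtain ⟨e, he⟩ := e
  unfold permVec
  congr 1
  refine propext ⟨fun ⟨a, ha⟩ => ⟨τ⁻¹ a, ?_⟩, fun ⟨a, ha⟩ => ⟨τ a, ?_⟩⟩
  · simp only at ha ⊢
    rw [ha, Sym2.map_mk]
    simp
  · simp only at ha ⊢
    have := congrArg (Sym2.map τ) ha
    rw [Sym2.map_map] at this
    simpa using this

/-- Summation over Hamiltonian cycles is proportional to summation over cyclic permutations. -/
lemma exists_sum_cyclicPerms_eq {n : ℕ} (hn : 2 ≤ n) : ∃ C : ℝ, 0 < C ∧
    ∀ g : (EdgeIdx n → ℝ) → ℝ, ∑ c ∈ cyclicPerms (Finset.univ : Finset (Fin n)), g (permVec c) =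
      C * ∑ x ∈ hamX n, g x := by
  set conj : Equiv.Perm (Fin n) → Equiv.Perm (Fin n) := fun σ => σ * finRotate n * σ⁻¹ with hconj
  have hmul : ∀ τ σ, conj (τ * σ) = τ * conj σ * τ⁻¹ := fun τ σ => by
    simp only [hconj]; group
  have h1 := fun g => sum_comp_eq_card_mul_sum_image (cycleVec n) (fun τ σ σ' h => by
    rw [cycleVec_eq_permVec, cycleVec_eq_permVec] at h ⊢
    change permVec (conj (τ * σ)) = permVec (conj (τ * σ'))
    change permVec (conj σ) = permVec (conj σ') at h
    funext e
    rw [hmul, hmul, permVec_conj τ (conj σ), permVec_conj τ (conj σ'), h]) g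
  have h2 := fun g => sum_comp_eq_card_mul_sum_image conj (fun τ σ σ' h => by
    rw [hmul, hmul, h]) g
  rw [image_conj_finRotate hn] at h2
  set A : ℝ := ((Finset.univ.filter fun σ => cycleVec n σ = cycleVec n 1).card : ℝ)
  set B : ℝ := ((Finset.univ.filter fun σ => conj σ = conj 1).card : ℝ)
  have hA : 0 < A := Nat.cast_pos.2 (Finset.card_pos.2 ⟨1, by simp⟩)
  have hB : 0 < B := Nat.cast_pos.2 (Finset.card_pos.2 ⟨1, by simp⟩)
  refine ⟨A / B, div_pos hA hB, fun g => ?_⟩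
  have h3 := h1 g
  simp_rw [cycleVec_eq_permVec] at h3
  have h4 := h2 (fun c => g (permVec c))
  change _ = A * ∑ x ∈ hamX n, g x at h3
  rw [div_mul_eq_mul_div, eq_div_iff hB.ne', ← h3, mul_comm, ← h4]

/-- The monomial of the edges of a partial matching of the cycle `ρ`. -/
lemma exists_polynomial_eval_sq {n K : ℕ} (hn : 3 ≤ n) (hK : n = 2 * K + 1)
    {ρ : Equiv.Perm (Fin n)} (hρ : IsCyclicOn Finset.univ ρ) (z : Fin n) {J : Finset ℕ}
    (hJ : J ⊆ Finset.range K) : ∃ h : MvPolynomial (EdgeIdx n) ℝ, h.totalDegree ≤ J.card ∧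
      ∀ c, IsCyclicOn Finset.univ c →
        (MvPolynomial.eval (permVec c) h) ^ 2 = matchingInd ρ z J c := by
  have hK' : Fintype.card (Fin n) = 2 * K + 1 := by rw [Fintype.card_fin, hK]
  have hdiag : ∀ j : J, ¬ (s(edgeFst ρ z j, edgeSnd ρ z j) : Sym2 (Fin n)).IsDiag := fun j => by
    rw [Sym2.mk_isDiag_iff]
    exact edgeFst_ne_edgeSnd hρ hK' z (hJ j.2) (hJ j.2)
  refine ⟨∏ j ∈ J.attach, MvPolynomial.X ⟨s(edgeFst ρ z j, edgeSnd ρ z j), hdiag j⟩, ?_, ?_⟩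
  · refine (MvPolynomial.totalDegree_finsetProd _ _).trans ?_
    simp
  · intro c hc
    rw [map_prod, ← Finset.prod_pow, matchingInd, ← Finset.prod_attach J]
    refine Finset.prod_congr rfl fun j _ => ?_
    rw [MvPolynomial.eval_X, ← permVec_mk hn hc (hdiag j)]
    unfold permVec
    split_ifs <;> norm_num

lemma sum_permVec {n : ℕ} (hn : 3 ≤ n) :
    ∑ c ∈ cyclicPerms (Finset.univ : Finset (Fin n)), permVec c =
      (2 * ((n - 2).factorial : ℝ)) • (1 : EdgeIdx n → ℝ) := by
  funext ⟨e, he⟩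
  induction e using Sym2.ind with
  | _ a b =>
    have hab : a ≠ b := by simpa using he
    have key : ∀ {a b : Fin n}, a ≠ b → ∑ c ∈ cyclicPerms (Finset.univ : Finset (Fin n)),
        arcInd c a b = ((n - 2).factorial : ℝ) := fun h => by
      simpa using sum_prod_arcInd_mul (J := (∅ : Finset ℕ)) (p := fun _ => a) (q := fun _ => a)
        (by simp) (by simp) (by simp) h (by simp)
    rw [Finset.sum_apply, Finset.sum_congr rfl fun c hc =>
      permVec_mk hn (mem_cyclicPerms.1 hc) he, Finset.sum_add_distrib, key hab, key hab.symm]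
    simp
    ring

lemma sum_matchingInd_smul_permVec {n K k : ℕ} (hn : 3 ≤ n) (hK : n = 2 * K + 1) (hk : 1 ≤ k)
    {ρ : Equiv.Perm (Fin n)} (hρ : IsCyclicOn Finset.univ ρ) {d T : ℝ}
    (hd : d = ((2 * K + 1 - k - 2).factorial : ℝ) * 2 ^ k * K.choose k *
      (2 * (1 - k / (2 * K)) +
        (2 * K - 1) * (1 - k / K + k * (k - 1) / (4 * K * (K - 1)))))
    (hT : T = (2 * K + 1) * K.choose k * (2 ^ k * ((2 * K + 1 - k - 1).factorial : ℝ))) :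
    ∑ z : Fin n, ∑ J ∈ (Finset.range K).powersetCard k,
      ∑ c ∈ cyclicPerms (Finset.univ : Finset (Fin n)), matchingInd ρ z J c • permVec c =
      (T - 2 * K * d) • permVec ρ + (2 * d) • (1 : EdgeIdx n → ℝ) := by
  have hK' : Fintype.card (Fin n) = 2 * K + 1 := by rw [Fintype.card_fin, hK]
  have hnon : ∀ a b : Fin n, a ≠ b → ρ a ≠ b → ρ b ≠ a → arcCount ρ K k a b = d :=
    fun a b h1 h2 h3 => by rw [hd]; exact arcCount_of_not_adj hρ hK' hk h1 h2 h3
  have hadj : ∀ a, arcCount ρ K k a (ρ a) + arcCount ρ K k (ρ a) a = T - (2 * K - 2) * d :=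
    fun a => by rw [hT]; exact arcCount_add_arcCount_of_adj hρ hK' (by omega) hnon a
  funext ⟨e, he⟩
  induction e using Sym2.ind with
  | _ a b =>
    have hab : a ≠ b := by simpa using he
    have hlhs : (∑ z : Fin n, ∑ J ∈ (Finset.range K).powersetCard k,
        ∑ c ∈ cyclicPerms (Finset.univ : Finset (Fin n)), matchingInd ρ z J c • permVec c)
          ⟨s(a, b), he⟩ = arcCount ρ K k a b + arcCount ρ K k b a := by
      unfold arcCount
      simp only [Finset.sum_apply, Pi.smul_apply, smul_eq_mul, ← Finset.sum_add_distrib]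
      refine Finset.sum_congr rfl fun z _ => Finset.sum_congr rfl fun J _ =>
        Finset.sum_congr rfl fun c hc => ?_
      rw [permVec_mk hn (mem_cyclicPerms.1 hc) he, mul_add]
    have hsum : permVec ρ ⟨s(a, b), he⟩ = arcInd ρ a b + arcInd ρ b a := permVec_mk hn hρ he
    rw [hlhs, Pi.add_apply, Pi.smul_apply, Pi.smul_apply, Pi.one_apply, smul_eq_mul, smul_eq_mul,
      mul_one]
    by_cases h1 : ρ a = b
    · have : permVec ρ ⟨s(a, b), he⟩ = 1 := if_pos ⟨a, by rw [h1]⟩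
      rw [this, ← h1, hadj]
      ring
    · by_cases h2 : ρ b = a
      · have : permVec ρ ⟨s(a, b), he⟩ = 1 := if_pos ⟨b, by rw [h2]; exact Sym2.eq_swap⟩
        rw [this, ← h2, add_comm, hadj]
        ring
      · rw [hsum, arcInd, arcInd, if_neg h1, if_neg h2, hnon a b hab h1 h2,
          hnon b a hab.symm h2 h1]
        ring

lemma lower_bound_of_weighted_nonneg {K k P y : ℝ} (hK : 4 ≤ K) (hk : 1 ≤ k) (hkK : k ≤ K)
    (hP : 0 < P)
    (h : 0 ≤ P * (((2 * K + 1) * (2 * K - k) - 2 * K * (2 * (1 - k / (2 * K)) +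
        (2 * K - 1) * (1 - k / K + k * (k - 1) / (4 * K * (K - 1))))) * y +
      2 * K * (2 * (1 - k / (2 * K)) +
        (2 * K - 1) * (1 - k / K + k * (k - 1) / (4 * K * (K - 1)))))) :
    -(2 * K + 1) / k + 1 - (2 * K + 1) * (k - 1) /
      (k * ((2 * K + 1) ^ 2 - (2 * K + 1) * k - 4 * (2 * K + 1) + 4 + 2 * k)) ≤ y := by
  have hK0 : K ≠ 0 := by linarith
  have hK1 : K - 1 ≠ 0 := by linarith
  have hk0 : k ≠ 0 := by linarith
  have hD : 0 < (2 * K - 1) * (2 * K - 1 - k) := mul_pos (by linarith) (by linarith)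
  set Q : ℝ := 2 * (1 - k / (2 * K)) +
    (2 * K - 1) * (1 - k / K + k * (k - 1) / (4 * K * (K - 1))) with hQ
  set L : ℝ := k * ((2 * K - 1) * (2 * K - 1 - k)) / (2 * (K - 1)) with hL
  have hLpos : 0 < L := div_pos (mul_pos (by linarith) hD) (by linarith)
  have hLQ : (2 * K + 1) * (2 * K - k) - 2 * K * Q = L := by
    rw [hQ, hL]
    field_simp
    ring
  have hbound : -(2 * K + 1) / k + 1 - (2 * K + 1) * (k - 1) /
      (k * ((2 * K + 1) ^ 2 - (2 * K + 1) * k - 4 * (2 * K + 1) + 4 + 2 * k)) =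
        1 - (2 * K + 1) * (2 * K - k) / L := by
    rw [show (2 * K + 1) ^ 2 - (2 * K + 1) * k - 4 * (2 * K + 1) + 4 + 2 * k =
      (2 * K - 1) * (2 * K - 1 - k) by ring, hL]
    have h1 : 2 * K - 1 ≠ 0 := by linarith
    have h2 : 2 * K - 1 - k ≠ 0 := by linarith
    field_simp
    ring
  have h0 := nonneg_of_mul_nonneg_right h hP
  rw [hLQ] at h0
  rw [hbound, sub_le_comm, le_div_iff₀ hLpos]
  linarith

/-- **Proposition, odd case.** Let `n ≥ 9` be odd, `1 ≤ k ≤ (n-1)/2`,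
`f ∈ P_k` and `y ∈ X`.  Then
`f(y) ≥ -n/k + 1 - n(k-1)/(k(n² - nk - 4n + 4 + 2k))`. -/
theorem lower_bound_on_Pk_odd
    (n k : ℕ) (hn : 9 ≤ n) (hodd : Odd n) (hk1 : 1 ≤ k) (hk2 : k ≤ (n - 1) / 2)
    (F : (EdgeIdx n → ℝ) →ₗ[ℝ] ℝ) (hF : memP n k F)
    (y : EdgeIdx n → ℝ) (hy : y ∈ hamX n) :
    -(n : ℝ) / k + 1 -
        (n : ℝ) * ((k : ℝ) - 1) /
          ((k : ℝ) * ((n : ℝ) ^ 2 - (n : ℝ) * k - 4 * n + 4 + 2 * k)) ≤ F y := by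
  obtain ⟨K, hK⟩ := hodd
  have hkK : k ≤ K := by omega
  obtain ⟨σ, -, rfl⟩ := Finset.mem_image.1 hy
  rw [cycleVec_eq_permVec]
  set ρ := σ * finRotate n * σ⁻¹
  have hρ : IsCyclicOn Finset.univ ρ := (isCyclicOn_finRotate (by omega)).conj σ
  obtain ⟨C, hC, hsum⟩ := exists_sum_cyclicPerms_eq (n := n) (by omega)
  obtain ⟨hF1, hF2⟩ := hF
  have hX : 0 < ((hamX n).card : ℝ) := Nat.cast_pos.2 (Finset.card_pos.2 ⟨_, hy⟩)
  have hone : F 1 = K := by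
    have h1 : ∑ x ∈ hamX n, F x = (hamX n).card := by field_simp at hF1; exact hF1
    have h2 := hsum F
    have h3 := hsum fun _ => 1
    rw [← map_sum, sum_permVec (by omega), map_smul, h1] at h2
    simp only [Finset.sum_const, nsmul_eq_mul, mul_one] at h3
    rw [← h3, card_cyclicPerms _ ⟨⟨0, by omega⟩, Finset.mem_univ _⟩, Finset.card_univ,
      Fintype.card_fin, show n - 1 = (n - 2) + 1 by omega, Nat.factorial_succ, smul_eq_mul] at h2
    have h4 : ((n - 2 + 1 : ℕ) : ℝ) = 2 * K := by
      rw [show n - 2 + 1 = 2 * K by omega]; push_cast; ring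
    rw [Nat.cast_mul, h4] at h2
    have h5 : (0 : ℝ) < ((n - 2).factorial : ℝ) := by positivity
    refine mul_left_cancel₀ (mul_pos two_pos h5).ne' ?_
    linarith
  have hnonneg : 0 ≤ F (∑ z : Fin n, ∑ J ∈ (Finset.range K).powersetCard k,
      ∑ c ∈ cyclicPerms (Finset.univ : Finset (Fin n)), matchingInd ρ z J c • permVec c) := by
    simp only [map_sum, map_smul, smul_eq_mul]
    refine Finset.sum_nonneg fun z _ => Finset.sum_nonneg fun J hJ => ?_
    obtain ⟨hJ1, hJ2⟩ := Finset.mem_powersetCard.1 hJ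
    obtain ⟨h, hdeg, heval⟩ := exists_polynomial_eval_sq (by omega) hK hρ z hJ1
    have h1 := hF2 h (hJ2 ▸ hdeg)
    have h2 := hsum fun x => F x * (MvPolynomial.eval x h) ^ 2
    rw [Finset.sum_congr rfl fun c hc => by
      rw [← heval c (mem_cyclicPerms.1 hc), mul_comm], h2]
    exact mul_nonneg hC.le (nonneg_of_mul_nonneg_right h1 (inv_pos.2 hX))
  rw [sum_matchingInd_smul_permVec (by omega) hK hk1 hρ rfl rfl, map_add, map_smul, map_smul, hone,
    smul_eq_mul, smul_eq_mul] at hnonneg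
  generalize F (permVec ρ) = y at hnonneg ⊢
  rw [show 2 * K + 1 - k - 1 = (2 * K + 1 - k - 2) + 1 by omega, Nat.factorial_succ,
    Nat.cast_mul] at hnonneg
  have hm : ((2 * K + 1 - k - 2 + 1 : ℕ) : ℝ) = 2 * K - k := by
    rw [show 2 * K + 1 - k - 2 + 1 = 2 * K - k by omega, Nat.cast_sub (by omega)]; push_cast; ring
  rw [hm] at hnonneg
  have hf : (0 : ℝ) < ((2 * K + 1 - k - 2).factorial : ℝ) * 2 ^ k * K.choose k := by
    have := Nat.choose_pos hkK
    positivity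
  have hnR : (n : ℝ) = 2 * K + 1 := by rw [hK]; push_cast; ring
  have hKR : (4 : ℝ) ≤ K := by
    have : 4 ≤ K := by omega
    exact_mod_cast this
  have hkR : (1 : ℝ) ≤ k := by exact_mod_cast hk1
  have hkKR : (k : ℝ) ≤ K := by exact_mod_cast hkK
  rw [hnR]
  refine lower_bound_of_weighted_nonneg hKR hkR hkKR hf (hnonneg.trans_eq ?_)
  ring
end
end

section
/- Let n ≥ 6, let U ⊂ {1, ..., n} with |U| = m, 3 ≤ m ≤ n/2, let i, j ∈ U be distinct and p, q ∈ {1, ..., n} \ U be distinct. Let u be the degree-1 polynomial u(x) = x_{ip} - x_{iq} + x_{jq} - x_{jp}. Then for every polynomial w of degree at most 1 on ℝ^{n(n-1)/2}, (1/|X|) Σ_{x∈X} h_U(x) u(x) w(x) = (2(m(n-3)(n-m) - (n-2)²)/((n-2)(n-3)(m-1)(n-m-1))) ⟨u, w⟩, where ⟨·,·⟩ is the inner product making the monomial basis {1} ∪ {x_{st} : 1 ≤ s < t ≤ n} orthonormal; i.e., u is an eigenvector of the matrix of the quadratic form q_{h_U} with eigenvalue 2(m(n-3)(n-m) - (n-2)²)/((n-2)(n-3)(m-1)(n-m-1)).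 -/
open Finset
noncomputable section
open scoped Classical

/-- The entry `x_{ij}` of a vector `x : EdgeIdx n → ℝ` at the unordered pair `{i,j}`
(conventionally `0` if `i = j`). -/
def xval {n : ℕ} (x : EdgeIdx n → ℝ) (i j : Fin n) : ℝ :=
  if h : i = j then 0 else x ⟨s(i, j), by simpa [Sym2.isDiag_iff_proj_eq] using h⟩

/-- The subtour elimination function `h_U(x) = c (Σ_{u∈U, v∉U} x_{uv} - 2)` with
`c = (n-1)/(2(m(n-m)+1-n))`, where `m = |U|` (so that `h_U` has average value `1`
on `X`). -/
def hU {n : ℕ} (U : Finset (Fin n)) (x : EdgeIdx n → ℝ) : ℝ :=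
  (((n : ℝ) - 1) / (2 * ((U.card : ℝ) * ((n : ℝ) - (U.card : ℝ)) + 1 - (n : ℝ)))) *
    ((∑ u ∈ U, ∑ v ∈ Uᶜ, xval x u v) - 2)

/-- Coefficient vector (in the monomial basis `{x_{pq}}`) of the degree-1 polynomial
`x_{ab} - x_{bc} + x_{cd} - x_{da}` for distinct vertices `a, b, c, d`. -/
def quadCoef {n : ℕ} (a b c d : Fin n) : EdgeIdx n → ℝ := fun e =>
  (if (e : Sym2 (Fin n)) = s(a, b) then 1 else 0)
    - (if (e : Sym2 (Fin n)) = s(b, c) then 1 else 0)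
    + (if (e : Sym2 (Fin n)) = s(c, d) then 1 else 0)
    - (if (e : Sym2 (Fin n)) = s(d, a) then 1 else 0)


/-- The properties of the adjacency function of a Hamiltonian cycle that determine its
moments up to order three. -/
structure IsCycleAdj {n : ℕ} (y : Fin n → Fin n → ℝ) : Prop where
  symm : ∀ a b, y a b = y b a
  diag : ∀ a, y a a = 0
  sq : ∀ a b, y a b * y a b = y a b
  degree : ∀ a, ∑ b, y a b = 2
  triangle : ∀ a b c, y a b * y b c * y c a = 0

theorem finRotate_iterate_ne {n : ℕ} (hn : 4 ≤ n) (k : Fin n) :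
    finRotate n k ≠ k ∧ finRotate n (finRotate n k) ≠ k ∧
      finRotate n (finRotate n (finRotate n k)) ≠ k := by
  obtain ⟨N, rfl⟩ : ∃ N, n = N + 1 := ⟨n - 1, by omega⟩
  have key : ∀ j : Fin (N + 1), ((finRotate (N + 1) j : Fin (N + 1)) : ℕ)
      = if (j : ℕ) = N then 0 else (j : ℕ) + 1 := by
    intro j
    rw [coe_finRotate]
    simp [Fin.ext_iff]
  have hk := k.2
  refine ⟨?_, ?_, ?_⟩ <;> intro h <;> have h := congrArg Fin.val h <;>
    simp only [key] at h <;> split_ifs at h <;> omega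

theorem xval_cycleVec {n : ℕ} (hn : 4 ≤ n) (σ : Equiv.Perm (Fin n)) (s t : Fin n) :
    xval (cycleVec n σ) s t =
      (if t = (σ * finRotate n * σ⁻¹) s then 1 else 0)
        + (if t = (σ * finRotate n * σ⁻¹)⁻¹ s then 1 else 0) := by
  obtain ⟨k, rfl⟩ := σ.surjective s
  obtain ⟨l, rfl⟩ := σ.surjective t
  have hk := finRotate_iterate_ne hn k
  have hl := finRotate_iterate_ne hn l
  have h1 : (σ l = (σ * finRotate n * σ⁻¹) (σ k)) ↔ l = finRotate n k := by simp
  have h2 : (σ l = (σ * finRotate n * σ⁻¹)⁻¹ (σ k)) ↔ finRotate n l = k := by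
    rw [Equiv.Perm.eq_inv_iff_eq]; simp
  simp only [h1, h2, xval, cycleVec]
  have h3 : (∃ i, s(σ k, σ l) = s(σ i, σ (finRotate n i))) ↔
      l = finRotate n k ∨ finRotate n l = k := by
    constructor
    · rintro ⟨i, hi⟩
      rw [Sym2.eq_iff] at hi
      simp only [EmbeddingLike.apply_eq_iff_eq] at hi
      grind
    · rintro (h | h)
      · exact ⟨k, by rw [h]⟩
      · exact ⟨l, by rw [h, Sym2.eq_swap]⟩
  simp only [h3, EmbeddingLike.apply_eq_iff_eq]
  by_cases a1 : l = finRotate n k <;> by_cases a2 : finRotate n l = k <;> grind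

theorem isCycleAdj_xval {n : ℕ} (hn : 4 ≤ n) {x : EdgeIdx n → ℝ} (hx : x ∈ hamX n) :
    IsCycleAdj (xval x) := by
  simp only [hamX, mem_image, mem_univ, true_and] at hx
  obtain ⟨σ, rfl⟩ := hx
  have hρ : ∀ s, (σ * finRotate n * σ⁻¹) s ≠ s ∧
      (σ * finRotate n * σ⁻¹) ((σ * finRotate n * σ⁻¹) s) ≠ s ∧
      (σ * finRotate n * σ⁻¹) ((σ * finRotate n * σ⁻¹) ((σ * finRotate n * σ⁻¹) s)) ≠ s := by
    intro s
    obtain ⟨k, rfl⟩ := σ.surjective s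
    simpa using finRotate_iterate_ne hn k
  have hv := xval_cycleVec hn σ
  generalize σ * finRotate n * σ⁻¹ = ρ at hρ hv
  have hv' : ∀ s t, xval (cycleVec n σ) s t =
      (if t = ρ s then 1 else 0) + (if s = ρ t then 1 else 0) := by
    intro s t
    have h : t = ρ⁻¹ s ↔ s = ρ t := by rw [Equiv.Perm.eq_inv_iff_eq, eq_comm]
    simp only [hv, h]
  refine ⟨?_, ?_, ?_, ?_, ?_⟩
  · intro a b; rw [hv', hv', add_comm]
  · intro a
    have := hρ a
    rw [hv', if_neg this.1.symm]; simp
  · intro a b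
    have := hρ a
    rw [hv']
    grind
  · intro a
    simp only [hv, sum_add_distrib, sum_ite_eq', mem_univ, if_true]
    norm_num
  · intro a b c
    have h1 := hρ a
    have h2 := hρ b
    have h3 := hρ c
    have i1 : ∀ s t, ρ s = ρ t → s = t := fun s t h => ρ.injective h
    have e1 := i1 a b
    have e2 := i1 b c
    have e3 := i1 c a
    clear i1 hρ
    rw [hv', hv', hv']
    simp only [mul_eq_zero]
    by_contra! hne
    have o : ∀ s t, (if t = ρ s then (1 : ℝ) else 0) + (if s = ρ t then 1 else 0) ≠ 0 →
        t = ρ s ∨ s = ρ t := by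
      intro s t h
      by_contra! h'
      exact h (by simp [h'.1, h'.2])
    rcases o _ _ hne.1.1 with h | h <;> rcases o _ _ hne.1.2 with h' | h' <;>
      rcases o _ _ hne.2 with h'' | h'' <;> grind

theorem IsCycleAdj.eq_zero_or_one {n : ℕ} {y : Fin n → Fin n → ℝ} (hy : IsCycleAdj y)
    (a b : Fin n) : y a b = 0 ∨ y a b = 1 := by
  have h : y a b * (y a b - 1) = 0 := by linear_combination hy.sq a b
  rcases mul_eq_zero.1 h with h | h
  · exact Or.inl h
  · exact Or.inr (by linarith)

theorem IsCycleAdj.star {n : ℕ} {y : Fin n → Fin n → ℝ} (hy : IsCycleAdj y)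
    {a b c d : Fin n} (hbc : b ≠ c) (hbd : b ≠ d) (hcd : c ≠ d) :
    y a b * y a c * y a d = 0 := by
  have h := hy.degree a
  have h3 : ∑ e ∈ {b, c, d}, y a e ≤ ∑ e, y a e :=
    sum_le_sum_of_subset_of_nonneg (subset_univ _) fun e _ _ => by
      rcases hy.eq_zero_or_one a e with h | h <;> simp [h]
  rw [sum_insert (by simp [hbc, hbd]), sum_insert (by simp [hcd]), sum_singleton] at h3
  rcases hy.eq_zero_or_one a b with h4 | h4 <;> rcases hy.eq_zero_or_one a c with h5 | h5 <;>
    rcases hy.eq_zero_or_one a d with h6 | h6 <;> rw [h4, h5, h6] at h3 ⊢ <;> linarith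

/-- Relabelling the vertices of a point of `ℝ^{n(n-1)/2}` by a permutation. -/
def relabel {n : ℕ} (π : Equiv.Perm (Fin n)) (x : EdgeIdx n → ℝ) : EdgeIdx n → ℝ :=
  fun e => x ⟨e.1.map π, fun h => e.2 ((Sym2.isDiag_map π.injective).1 h)⟩

theorem xval_relabel {n : ℕ} (π : Equiv.Perm (Fin n)) (x : EdgeIdx n → ℝ) :
    xval (relabel π x) = fun s t => xval x (π s) (π t) := by
  funext s t
  simp [xval, relabel]

theorem relabel_mem_hamX {n : ℕ} (π : Equiv.Perm (Fin n)) {x : EdgeIdx n → ℝ}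
    (hx : x ∈ hamX n) : relabel π x ∈ hamX n := by
  simp only [hamX, mem_image, mem_univ, true_and] at hx ⊢
  obtain ⟨σ, rfl⟩ := hx
  refine ⟨π⁻¹ * σ, ?_⟩
  funext e
  simp only [relabel, cycleVec]
  congr 1
  apply propext
  refine exists_congr fun k => ?_
  rw [← (Sym2.map.injective π.injective).eq_iff]
  simp

/-- The sum over all Hamiltonian cycles of a function of the adjacency function. -/
def hamSum (n : ℕ) (F : (Fin n → Fin n → ℝ) → ℝ) : ℝ := ∑ x ∈ hamX n, F (xval x)

theorem hamSum_congr {n : ℕ} (hn : 4 ≤ n) {F G : (Fin n → Fin n → ℝ) → ℝ}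
    (h : ∀ y, IsCycleAdj y → F y = G y) : hamSum n F = hamSum n G :=
  sum_congr rfl fun _ hx => h _ (isCycleAdj_xval hn hx)

theorem hamSum_eq_zero {n : ℕ} (hn : 4 ≤ n) {F : (Fin n → Fin n → ℝ) → ℝ}
    (h : ∀ y, IsCycleAdj y → F y = 0) : hamSum n F = 0 :=
  sum_eq_zero fun _ hx => h _ (isCycleAdj_xval hn hx)

theorem hamSum_relabel {n : ℕ} (π : Equiv.Perm (Fin n)) (F : (Fin n → Fin n → ℝ) → ℝ) :
    hamSum n (fun y => F fun s t => y (π s) (π t)) = hamSum n F := by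
  refine sum_nbij' (relabel π) (relabel π⁻¹) (fun _ => relabel_mem_hamX π)
    (fun _ => relabel_mem_hamX _) ?_ ?_ ?_
  · intro x _; funext e; simp [relabel, Sym2.map_map]
  · intro x _; funext e; simp [relabel, Sym2.map_map]
  · intro x _; rw [xval_relabel]

/-- The degree equation at `b`, multiplied by a function `M` that only depends on the vertices
in `A`: all vertices `c` outside `A` contribute equally. -/
theorem hamSum_degree {n : ℕ} (hn : 4 ≤ n) (A : Finset (Fin n)) {b : Fin n} (hb : b ∈ A)
    (M : (Fin n → Fin n → ℝ) → ℝ)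
    (hM : ∀ π : Equiv.Perm (Fin n), (∀ a ∈ A, π a = a) →
      ∀ y, M (fun s t => y (π s) (π t)) = M y)
    {c : Fin n} (hc : c ∉ A) :
    ((n : ℝ) - #A) * hamSum n (fun y => M y * y b c)
      + ∑ a ∈ A, hamSum n (fun y => M y * y b a) = 2 * hamSum n M := by
  have hconst : ∀ c' ∈ Aᶜ, hamSum n (fun y => M y * y b c') = hamSum n (fun y => M y * y b c) := by
    intro c' hc'
    rw [mem_compl] at hc'
    have hfix : ∀ a ∈ A, Equiv.swap c c' a = a := fun a ha =>
      Equiv.swap_apply_of_ne_of_ne (fun h => hc (h ▸ ha)) (fun h => hc' (h ▸ ha))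
    rw [← hamSum_relabel (Equiv.swap c c') (fun y => M y * y b c)]
    simp [hM _ hfix, hfix b hb]
  have htotal : ∑ a, hamSum n (fun y => M y * y b a) = 2 * hamSum n M := by
    simp only [hamSum]
    rw [sum_comm, mul_sum]
    refine sum_congr rfl fun x hx => ?_
    rw [← mul_sum, (isCycleAdj_xval hn hx).degree, mul_comm]
  rw [← htotal, ← sum_add_sum_compl A, sum_congr rfl hconst, sum_const, card_compl,
    Fintype.card_fin, nsmul_eq_mul, Nat.cast_sub (by simpa using card_le_univ A)]
  ring

/-- The number of Hamiltonian cycles through a fixed path with three edges. -/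
def pathCount (n : ℕ) : ℝ := 2 * #(hamX n) / (((n : ℝ) - 1) * ((n : ℝ) - 2) * ((n : ℝ) - 3))

section Moments

variable {n : ℕ} {a b c d e f : Fin n}

theorem hamSum_edge (hn : 6 ≤ n) (hab : a ≠ b) :
    hamSum n (fun y => y a b) = ((n : ℝ) - 2) * ((n : ℝ) - 3) * pathCount n := by
  have hn' : (6 : ℝ) ≤ n := by exact_mod_cast hn
  have h1 : (n : ℝ) - 1 ≠ 0 := by linarith
  have h2 : (n : ℝ) - 2 ≠ 0 := by linarith
  have h3 : (n : ℝ) - 3 ≠ 0 := by linarith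
  have h := hamSum_degree (by omega) {a} (mem_singleton_self a) (fun _ => 1)
    (fun _ _ _ => rfl) (c := b) (by simpa using hab.symm)
  have h0 : hamSum n (fun y => y a a) = 0 := hamSum_eq_zero (by omega) fun y hy => hy.diag a
  have hX : hamSum n (fun _ => 1) = #(hamX n) := by simp [hamSum]
  simp only [card_singleton, one_mul, sum_singleton, h0, hX] at h
  rw [pathCount]
  field_simp
  push_cast at h
  linarith

theorem hamSum_cherry (hn : 6 ≤ n) (hab : a ≠ b) (hac : a ≠ c) (hbc : b ≠ c) :
    hamSum n (fun y => y a b * y b c) = ((n : ℝ) - 3) * pathCount n := by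
  have hn' : (6 : ℝ) ≤ n := by exact_mod_cast hn
  have h2 : (n : ℝ) - 2 ≠ 0 := by linarith
  have h := hamSum_degree (by omega) {a, b} (b := b) (by simp) (fun y => y a b)
    (by intro π h y; simp at h; simp [h]) (c := c) (by simp [hac.symm, hbc.symm])
  have h0 : hamSum n (fun y => y a b * y b b) = 0 :=
    hamSum_eq_zero (by omega) fun y hy => by rw [hy.diag, mul_zero]
  have h1 : hamSum n (fun y => y a b * y b a) = hamSum n (fun y => y a b) :=
    hamSum_congr (by omega) fun y hy => by rw [hy.symm b a, hy.sq]
  rw [sum_pair hab, card_pair hab, h0, h1, hamSum_edge hn hab] at h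
  apply mul_left_cancel₀ h2
  push_cast at h
  linarith

theorem hamSum_twoEdges (hn : 6 ≤ n) (hab : a ≠ b) (hac : a ≠ c) (had : a ≠ d) (hbc : b ≠ c)
    (hbd : b ≠ d) (hcd : c ≠ d) :
    hamSum n (fun y => y a b * y c d) = 2 * ((n : ℝ) - 3) * pathCount n := by
  have hn' : (6 : ℝ) ≤ n := by exact_mod_cast hn
  have h3 : (n : ℝ) - 3 ≠ 0 := by linarith
  have h := hamSum_degree (by omega) {a, b, c} (b := c) (by simp) (fun y => y a b)
    (by intro π h y; simp at h; simp [h]) (c := d) (by simp [had.symm, hbd.symm, hcd.symm])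
  have h0 : hamSum n (fun y => y a b * y c c) = 0 :=
    hamSum_eq_zero (by omega) fun y hy => by rw [hy.diag, mul_zero]
  have h1 : hamSum n (fun y => y a b * y c a) = ((n : ℝ) - 3) * pathCount n := by
    rw [← hamSum_cherry hn hab.symm hbc hac]
    exact hamSum_congr (by omega) fun y hy => by rw [hy.symm a b, hy.symm c a]
  have h2 : hamSum n (fun y => y a b * y c b) = ((n : ℝ) - 3) * pathCount n := by
    rw [← hamSum_cherry hn hab hac hbc]
    exact hamSum_congr (by omega) fun y hy => by rw [hy.symm c b]
  rw [sum_insert (by simp [hab, hac]), sum_pair hbc, card_eq_three.2 ⟨a, b, c, hab, hac, hbc, rfl⟩,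
    h0, h1, h2, hamSum_edge hn hab] at h
  apply mul_left_cancel₀ h3
  push_cast at h
  linarith

theorem hamSum_path (hn : 6 ≤ n) (hab : a ≠ b) (hac : a ≠ c) (had : a ≠ d) (hbc : b ≠ c)
    (hbd : b ≠ d) (hcd : c ≠ d) :
    hamSum n (fun y => y a b * y b c * y c d) = pathCount n := by
  have hn' : (6 : ℝ) ≤ n := by exact_mod_cast hn
  have h3 : (n : ℝ) - 3 ≠ 0 := by linarith
  have h := hamSum_degree (by omega) {a, b, c} (b := c) (by simp) (fun y => y a b * y b c)
    (by intro π h y; simp at h; simp [h]) (c := d) (by simp [had.symm, hbd.symm, hcd.symm])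
  have h0 : hamSum n (fun y => y a b * y b c * y c c) = 0 :=
    hamSum_eq_zero (by omega) fun y hy => by rw [hy.diag, mul_zero]
  have h1 : hamSum n (fun y => y a b * y b c * y c a) = 0 :=
    hamSum_eq_zero (by omega) fun y hy => hy.triangle a b c
  have h2 : hamSum n (fun y => y a b * y b c * y c b) = ((n : ℝ) - 3) * pathCount n := by
    rw [← hamSum_cherry hn hab hac hbc]
    exact hamSum_congr (by omega) fun y hy => by rw [hy.symm c b, mul_assoc, hy.sq]
  rw [sum_insert (by simp [hab, hac]), sum_pair hbc, card_eq_three.2 ⟨a, b, c, hab, hac, hbc, rfl⟩,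
    h0, h1, h2, hamSum_cherry hn hab hac hbc] at h
  apply mul_left_cancel₀ h3
  push_cast at h
  linarith

theorem hamSum_cherry_edge (hn : 6 ≤ n) (hab : a ≠ b) (hac : a ≠ c) (had : a ≠ d) (hae : a ≠ e)
    (hbc : b ≠ c) (hbd : b ≠ d) (hbe : b ≠ e) (hcd : c ≠ d) (hce : c ≠ e) (hde : d ≠ e) :
    hamSum n (fun y => y a b * y b c * y d e) = 2 * pathCount n := by
  have hn' : (6 : ℝ) ≤ n := by exact_mod_cast hn
  have h4 : (n : ℝ) - 4 ≠ 0 := by linarith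
  have h := hamSum_degree (by omega) {a, b, c, d} (b := d) (by simp) (fun y => y a b * y b c)
    (by intro π h y; simp at h; simp [h]) (c := e)
    (by simp [hae.symm, hbe.symm, hce.symm, hde.symm])
  have h0 : hamSum n (fun y => y a b * y b c * y d d) = 0 :=
    hamSum_eq_zero (by omega) fun y hy => by rw [hy.diag, mul_zero]
  have h1 : hamSum n (fun y => y a b * y b c * y d a) = pathCount n := by
    rw [← hamSum_path hn had.symm hbd.symm hcd.symm hab hac hbc]
    exact hamSum_congr (by omega) fun y hy => by ring
  have h2 : hamSum n (fun y => y a b * y b c * y d b) = 0 :=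
    hamSum_eq_zero (by omega) fun y hy => by
      rw [hy.symm a b, hy.symm d b, hy.star hac had hcd]
  have h3 : hamSum n (fun y => y a b * y b c * y d c) = pathCount n := by
    rw [← hamSum_path hn hab hac had hbc hbd hcd]
    exact hamSum_congr (by omega) fun y hy => by rw [hy.symm d c]
  rw [sum_insert (by simp [hab, hac, had]), sum_insert (by simp [hbc, hbd]), sum_pair hcd,
    card_insert_of_notMem (by simp [hab, hac, had]),
    card_eq_three.2 ⟨b, c, d, hbc, hbd, hcd, rfl⟩,
    h0, h1, h2, h3, hamSum_cherry hn hab hac hbc] at h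
  apply mul_left_cancel₀ h4
  push_cast at h
  linarith

theorem hamSum_threeEdges (hn : 6 ≤ n) (hab : a ≠ b) (hac : a ≠ c) (had : a ≠ d) (hae : a ≠ e)
    (haf : a ≠ f) (hbc : b ≠ c) (hbd : b ≠ d) (hbe : b ≠ e) (hbf : b ≠ f) (hcd : c ≠ d)
    (hce : c ≠ e) (hcf : c ≠ f) (hde : d ≠ e) (hdf : d ≠ f) (hef : e ≠ f) :
    hamSum n (fun y => y a b * y c d * y e f) = 4 * pathCount n := by
  have hn' : (6 : ℝ) ≤ n := by exact_mod_cast hn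
  have h5 : (n : ℝ) - 5 ≠ 0 := by linarith
  have h := hamSum_degree (by omega) {a, b, c, d, e} (b := e) (by simp) (fun y => y a b * y c d)
    (by intro π h y; simp at h; simp [h]) (c := f)
    (by simp [haf.symm, hbf.symm, hcf.symm, hdf.symm, hef.symm])
  have h0 : hamSum n (fun y => y a b * y c d * y e e) = 0 :=
    hamSum_eq_zero (by omega) fun y hy => by rw [hy.diag, mul_zero]
  have h1 : hamSum n (fun y => y a b * y c d * y e a) = 2 * pathCount n := by
    rw [← hamSum_cherry_edge hn hae.symm hbe.symm hce.symm hde.symm hab hac had hbc hbd hcd]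
    exact hamSum_congr (by omega) fun y hy => by ring
  have h2 : hamSum n (fun y => y a b * y c d * y e b) = 2 * pathCount n := by
    rw [← hamSum_cherry_edge hn hab hae hac had hbe hbc hbd hce.symm hde.symm hcd]
    exact hamSum_congr (by omega) fun y hy => by rw [hy.symm e b]; ring
  have h3 : hamSum n (fun y => y a b * y c d * y e c) = 2 * pathCount n := by
    rw [← hamSum_cherry_edge hn hce.symm hde.symm hae.symm hbe.symm hcd hac.symm hbc.symm
      had.symm hbd.symm hab]
    exact hamSum_congr (by omega) fun y hy => by ring
  have h4 : hamSum n (fun y => y a b * y c d * y e d) = 2 * pathCount n := by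
    rw [← hamSum_cherry_edge hn hcd hce hac.symm hbc.symm hde had.symm hbd.symm
      hae.symm hbe.symm hab]
    exact hamSum_congr (by omega) fun y hy => by rw [hy.symm e d]; ring
  rw [sum_insert (by simp [hab, hac, had, hae]), sum_insert (by simp [hbc, hbd, hbe]),
    sum_insert (by simp [hcd, hce]), sum_pair hde,
    card_insert_of_notMem (by simp [hab, hac, had, hae]),
    card_insert_of_notMem (by simp [hbc, hbd, hbe]),
    card_eq_three.2 ⟨c, d, e, hcd, hce, hde, rfl⟩,
    h0, h1, h2, h3, h4, hamSum_twoEdges hn hab hac had hbc hbd hcd] at h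
  apply mul_left_cancel₀ h5
  push_cast at h
  linarith

end Moments

theorem sum_quadCoef_mul {n : ℕ} {a b c d : Fin n} (hab : a ≠ b) (hbc : b ≠ c) (hcd : c ≠ d)
    (hda : d ≠ a) (x : EdgeIdx n → ℝ) :
    ∑ e, quadCoef a b c d e * x e = xval x a b - xval x b c + xval x c d - xval x d a := by
  have key : ∀ s t : Fin n, s ≠ t →
      ∑ e : EdgeIdx n, (if (e : Sym2 (Fin n)) = s(s, t) then (1 : ℝ) else 0) * x e
        = xval x s t := by
    intro s t hst
    rw [xval, dif_neg hst, sum_eq_single ⟨s(s, t), by simpa using hst⟩]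
    · simp
    · intro e _ he
      rw [if_neg (fun h => he (Subtype.ext h)), zero_mul]
    · simp
  simp only [quadCoef, add_mul, sub_mul, sum_add_distrib, sum_sub_distrib]
  rw [key _ _ hab, key _ _ hbc, key _ _ hcd, key _ _ hda]

/-- The number of edges of `y` between `U` and its complement. -/
def cutValue {n : ℕ} (U : Finset (Fin n)) (y : Fin n → Fin n → ℝ) : ℝ :=
  ∑ s ∈ U, ∑ t ∈ Uᶜ, y s t

theorem cutValue_compl {n : ℕ} (U : Finset (Fin n)) {y : Fin n → Fin n → ℝ}
    (hy : IsCycleAdj y) : cutValue Uᶜ y = cutValue U y := by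
  rw [cutValue, cutValue, compl_compl, sum_comm]
  simp only [hy.symm]

theorem cutValue_relabel {n : ℕ} {U : Finset (Fin n)} {π : Equiv.Perm (Fin n)}
    (hπ : ∀ s, π s ∈ U ↔ s ∈ U) (y : Fin n → Fin n → ℝ) :
    cutValue U (fun s t => y (π s) (π t)) = cutValue U y := by
  refine sum_equiv π (fun s => (hπ s).symm) fun s _ => ?_
  exact sum_equiv π (fun t => by simp [hπ t]) fun t _ => rfl

theorem hamSum_cutValue_mul {n : ℕ} (U : Finset (Fin n)) (M : (Fin n → Fin n → ℝ) → ℝ) :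
    hamSum n (fun y => cutValue U y * M y) =
      ∑ s ∈ U, ∑ t ∈ Uᶜ, hamSum n (fun y => M y * y s t) := by
  simp only [hamSum, cutValue, sum_mul]
  rw [sum_comm]
  refine sum_congr rfl fun s _ => ?_
  rw [sum_comm]
  simp only [mul_comm]

section CutMoments

variable {n : ℕ} {U : Finset (Fin n)} {i j p q : Fin n}

theorem hamSum_cut_edge (hn : 6 ≤ n) (hi : i ∈ U) (hp : p ∉ U) :
    hamSum n (fun y => cutValue U y * y i p) =
      (((n : ℝ) - 2) * ((n : ℝ) - 3) + ((n : ℝ) - 2) * ((n : ℝ) - 3)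
        + 2 * ((#U : ℝ) - 1) * ((n : ℝ) - #U - 1) * ((n : ℝ) - 3)) * pathCount n := by
  have hip : i ≠ p := fun h => hp (h ▸ hi)
  have hcard : ((#Uᶜ : ℕ) : ℝ) = n - #U := by
    rw [card_compl, Fintype.card_fin, Nat.cast_sub (by simpa using card_le_univ U)]
  have key : ∀ s ∈ U, ∀ t ∈ Uᶜ, hamSum n (fun y => y i p * y s t) =
      (2 * ((n : ℝ) - 3) - (n - 3) * ((if s = i then 1 else 0) + (if t = p then 1 else 0))
        + (if s = i then 1 else 0) * (if t = p then 1 else 0) * ((n - 2) * (n - 3)))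
        * pathCount n := by
    intro s hs t ht
    rw [mem_compl] at ht
    have hst : s ≠ t := fun h => ht (h ▸ hs)
    have hsp : s ≠ p := fun h => hp (h ▸ hs)
    have hit : i ≠ t := fun h => ht (h ▸ hi)
    by_cases h1 : s = i <;> by_cases h2 : t = p
    · subst h1 h2
      rw [hamSum_congr (by omega) (fun y hy => hy.sq s t), hamSum_edge hn hip]
      simp only [eq_self, ↓reduceIte]; ring
    · subst h1
      rw [hamSum_congr (by omega) (G := fun y => y p s * y s t) (fun y hy => by
        rw [hy.symm s p]), hamSum_cherry hn hip.symm (Ne.symm h2) hst]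
      simp only [eq_self, h2, ↓reduceIte]; ring
    · subst h2
      rw [hamSum_congr (by omega) (G := fun y => y i t * y t s) (fun y hy => by
        rw [hy.symm s t]), hamSum_cherry hn hip (Ne.symm h1) hsp.symm]
      simp only [eq_self, h1, ↓reduceIte]; ring
    · rw [hamSum_twoEdges hn hip (Ne.symm h1) hit hsp.symm (Ne.symm h2) hst]
      simp [h1, h2]
  rw [hamSum_cutValue_mul, sum_congr rfl fun s hs => sum_congr rfl (key s hs)]
  simp only [← sum_mul, sum_add_distrib, sum_sub_distrib, ← mul_sum, sum_const, sum_ite_eq',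
    hi, mem_compl, hp, not_false_eq_true, if_true, nsmul_eq_mul, hcard]
  ring

theorem hamSum_cut_cherry (hn : 6 ≤ n) (hi : i ∈ U) (hp : p ∉ U) (hq : q ∉ U) (hpq : p ≠ q) :
    hamSum n (fun y => cutValue U y * (y p i * y i q)) =
      (2 * ((n : ℝ) - 3) + 2 * ((#U : ℝ) - 1)
        + 2 * ((#U : ℝ) - 1) * ((n : ℝ) - #U - 2)) * pathCount n := by
  have hip : i ≠ p := fun h => hp (h ▸ hi)
  have hiq : i ≠ q := fun h => hq (h ▸ hi)
  have hcard : ((#Uᶜ : ℕ) : ℝ) = n - #U := by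
    rw [card_compl, Fintype.card_fin, Nat.cast_sub (by simpa using card_le_univ U)]
  have key : ∀ s ∈ U, ∀ t ∈ Uᶜ, hamSum n (fun y => y p i * y i q * y s t) =
      (2 - 2 * (if s = i then 1 else 0) - ((if t = p then 1 else 0) + (if t = q then 1 else 0))
        + (if s = i then 1 else 0) * ((if t = p then 1 else 0) + (if t = q then 1 else 0))
          * ((n : ℝ) - 2)) * pathCount n := by
    intro s hs t ht
    rw [mem_compl] at ht
    have hst : s ≠ t := fun h => ht (h ▸ hs)
    have hsp : s ≠ p := fun h => hp (h ▸ hs)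
    have hsq : s ≠ q := fun h => hq (h ▸ hs)
    have hit : i ≠ t := fun h => ht (h ▸ hi)
    by_cases h1 : s = i
    · subst h1
      by_cases h2 : t = p
      · subst h2
        rw [hamSum_congr (by omega) (G := fun y => y t s * y s q) (fun y hy => by
          rw [hy.symm t s]; linear_combination y s q * hy.sq s t),
          hamSum_cherry hn hip.symm hpq hiq]
        simp only [eq_self, hpq, ↓reduceIte]; ring
      by_cases h3 : t = q
      · subst h3
        rw [hamSum_congr (by omega) (G := fun y => y p s * y s t) (fun y hy => by
          linear_combination y p s * hy.sq s t),
          hamSum_cherry hn hip.symm hpq hiq]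
        simp only [eq_self, hpq.symm, ↓reduceIte]; ring
      · rw [hamSum_eq_zero (by omega) fun y hy => by
          rw [hy.symm p s, hy.star hpq (Ne.symm h2) (Ne.symm h3)]]
        simp [h2, h3]
    · by_cases h2 : t = p
      · subst h2
        rw [hamSum_congr (by omega) (G := fun y => y s t * y t i * y i q) (fun y hy => by ring),
          hamSum_path hn hst h1 hsq hip.symm hpq hiq]
        simp only [eq_self, hpq, h1, ↓reduceIte]; ring
      by_cases h3 : t = q
      · subst h3
        rw [hamSum_congr (by omega) (G := fun y => y p i * y i t * y t s) (fun y hy => by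
          rw [hy.symm s t]),
          hamSum_path hn hip.symm hpq hsp.symm hiq (Ne.symm h1) hst.symm]
        simp only [eq_self, hpq.symm, h1, ↓reduceIte]; ring
      · rw [hamSum_cherry_edge hn hip.symm hpq hsp.symm (Ne.symm h2) hiq (Ne.symm h1) hit
          hsq.symm (Ne.symm h3) hst]
        simp [h1, h2, h3]
  rw [hamSum_cutValue_mul, sum_congr rfl fun s hs => sum_congr rfl (key s hs)]
  simp only [← sum_mul, sum_add_distrib, sum_sub_distrib, ← mul_sum, sum_const, sum_ite_eq',
    hi, mem_compl, hp, hq, not_false_eq_true, if_true, nsmul_eq_mul, hcard]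
  ring

theorem hamSum_cut_twoEdges (hn : 6 ≤ n) (hi : i ∈ U) (hj : j ∈ U) (hij : i ≠ j) (hp : p ∉ U)
    (hq : q ∉ U) (hpq : p ≠ q) :
    hamSum n (fun y => cutValue U y * (y i p * y j q)) =
      (4 * ((n : ℝ) - 3) + 2 + 4 * ((n : ℝ) - #U - 2) + 4 * ((#U : ℝ) - 2)
        + 4 * ((#U : ℝ) - 2) * ((n : ℝ) - #U - 2)) * pathCount n := by
  have hip : i ≠ p := fun h => hp (h ▸ hi)
  have hiq : i ≠ q := fun h => hq (h ▸ hi)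
  have hjp : j ≠ p := fun h => hp (h ▸ hj)
  have hjq : j ≠ q := fun h => hq (h ▸ hj)
  have hcard : ((#Uᶜ : ℕ) : ℝ) = n - #U := by
    rw [card_compl, Fintype.card_fin, Nat.cast_sub (by simpa using card_le_univ U)]
  have key : ∀ s ∈ U, ∀ t ∈ Uᶜ, hamSum n (fun y => y i p * y j q * y s t) =
      (4 - 2 * ((if s = i then 1 else 0) + (if s = j then 1 else 0))
        - 2 * ((if t = p then 1 else 0) + (if t = q then 1 else 0))
        + ((if s = i then 1 else 0) * (if t = p then 1 else 0)
          + (if s = j then 1 else 0) * (if t = q then 1 else 0)) * (2 * ((n : ℝ) - 3))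
        + ((if s = i then 1 else 0) * (if t = q then 1 else 0)
          + (if s = j then 1 else 0) * (if t = p then 1 else 0))) * pathCount n := by
    intro s hs t ht
    rw [mem_compl] at ht
    have hst : s ≠ t := fun h => ht (h ▸ hs)
    have hsp : s ≠ p := fun h => hp (h ▸ hs)
    have hsq : s ≠ q := fun h => hq (h ▸ hs)
    have hit : i ≠ t := fun h => ht (h ▸ hi)
    have hjt : j ≠ t := fun h => ht (h ▸ hj)
    by_cases h1 : s = i
    · subst h1
      by_cases h3 : t = p
      · subst h3
        rw [hamSum_congr (by omega) (G := fun y => y s t * y j q) (fun y hy => by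
          linear_combination y j q * hy.sq s t),
          hamSum_twoEdges hn hip hij hiq hjp.symm hpq hjq]
        simp only [eq_self, hij, hpq, ↓reduceIte]; ring
      by_cases h4 : t = q
      · subst h4
        rw [hamSum_congr (by omega) (G := fun y => y p s * y s t * y t j) (fun y hy => by
          rw [hy.symm p s, hy.symm t j]; ring),
          hamSum_path hn hip.symm hpq hjp.symm hiq hij hjq.symm]
        simp only [eq_self, hij, hpq.symm, ↓reduceIte]; ring
      · rw [hamSum_congr (by omega) (G := fun y => y p s * y s t * y j q) (fun y hy => by
          rw [hy.symm p s]; ring),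
          hamSum_cherry_edge hn hip.symm (Ne.symm h3) hjp.symm hpq hit hij hiq hjt.symm h4 hjq]
        simp only [eq_self, hij, h3, h4, ↓reduceIte]; ring
    by_cases h2 : s = j
    · subst h2
      by_cases h3 : t = p
      · subst h3
        rw [hamSum_congr (by omega) (G := fun y => y i t * y t s * y s q) (fun y hy => by
          rw [hy.symm t s]; ring),
          hamSum_path hn hip hij hiq hjp.symm hpq hjq]
        simp only [eq_self, h1, hpq, ↓reduceIte]; ring
      by_cases h4 : t = q
      · subst h4
        rw [hamSum_congr (by omega) (G := fun y => y i p * y s t) (fun y hy => by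
          linear_combination y i p * hy.sq s t),
          hamSum_twoEdges hn hip hij hiq hjp.symm hpq hjq]
        simp only [eq_self, h1, hpq.symm, ↓reduceIte]; ring
      · rw [hamSum_congr (by omega) (G := fun y => y q s * y s t * y i p) (fun y hy => by
          rw [hy.symm q s]; ring),
          hamSum_cherry_edge hn hjq.symm (Ne.symm h4) hiq.symm hpq.symm hjt hij.symm hjp
            hit.symm h3 hip]
        simp only [eq_self, h1, h3, h4, ↓reduceIte]; ring
    by_cases h3 : t = p
    · subst h3
      rw [hamSum_congr (by omega) (G := fun y => y i t * y t s * y j q) (fun y hy => by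
          rw [hy.symm t s]; ring),
        hamSum_cherry_edge hn hip (Ne.symm h1) hij hiq hst.symm hjp.symm hpq h2 hsq hjq]
      simp only [eq_self, h1, h2, hpq, ↓reduceIte]; ring
    by_cases h4 : t = q
    · subst h4
      rw [hamSum_congr (by omega) (G := fun y => y j t * y t s * y i p) (fun y hy => by
          rw [hy.symm t s]; ring),
        hamSum_cherry_edge hn hjq (Ne.symm h2) hij.symm hjp hst.symm hiq.symm hpq.symm h1 hsp hip]
      simp only [eq_self, h1, h2, hpq.symm, ↓reduceIte]; ring
    · rw [hamSum_threeEdges hn hip hij hiq (Ne.symm h1) hit hjp.symm hpq hsp.symm (Ne.symm h3)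
        hjq (Ne.symm h2) hjt hsq.symm (Ne.symm h4) hst]
      simp [h1, h2, h3, h4]
  rw [hamSum_cutValue_mul, sum_congr rfl fun s hs => sum_congr rfl (key s hs)]
  simp only [← sum_mul, sum_add_distrib, sum_sub_distrib, ← mul_sum, sum_const, sum_ite_eq',
    hi, hj, mem_compl, hp, hq, not_false_eq_true, if_true, nsmul_eq_mul, hcard]
  ring

/-- The alternating sum of `y` around the 4-cycle `p, i, q, j`. -/
def quadValue (p i q j : Fin n) (y : Fin n → Fin n → ℝ) : ℝ := y p i - y i q + y q j - y j p

theorem hamSum_cut_quad_edge (hn : 6 ≤ n) (hi : i ∈ U) (hj : j ∈ U) (hij : i ≠ j) (hp : p ∉ U)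
    (hq : q ∉ U) (hpq : p ≠ q) :
    hamSum n (fun y => (cutValue U y - 2) * quadValue p i q j y * y i p) =
      2 * ((#U : ℝ) * ((n : ℝ) - 3) * ((n : ℝ) - #U) - ((n : ℝ) - 2) ^ 2) * pathCount n := by
  have hip : i ≠ p := fun h => hp (h ▸ hi)
  have hiq : i ≠ q := fun h => hq (h ▸ hi)
  have hjp : j ≠ p := fun h => hp (h ▸ hj)
  have hjq : j ≠ q := fun h => hq (h ▸ hj)
  have hcard : ((#Uᶜ : ℕ) : ℝ) = n - #U := by
    rw [card_compl, Fintype.card_fin, Nat.cast_sub (by simpa using card_le_univ U)]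
  have expand : hamSum n (fun y => (cutValue U y - 2) * quadValue p i q j y * y i p) =
      hamSum n (fun y => cutValue U y * y i p)
        - hamSum n (fun y => cutValue U y * (y p i * y i q))
        + hamSum n (fun y => cutValue U y * (y i p * y j q))
        - hamSum n (fun y => cutValue Uᶜ y * (y i p * y p j))
        - 2 * (hamSum n (fun y => y i p) - hamSum n (fun y => y p i * y i q)
          + hamSum n (fun y => y i p * y j q) - hamSum n (fun y => y i p * y p j)) := by
    simp only [hamSum, ← sum_sub_distrib, ← sum_add_distrib, mul_sum]
    refine sum_congr rfl fun x hx => ?_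
    have hy := isCycleAdj_xval (by omega) hx
    rw [quadValue, cutValue_compl U hy, hy.symm p i, hy.symm q j, hy.symm p j]
    linear_combination (cutValue U (xval x) - 2) * hy.sq i p
  rw [expand, hamSum_cut_edge hn hi hp, hamSum_cut_cherry hn hi hp hq hpq,
    hamSum_cut_twoEdges hn hi hj hij hp hq hpq,
    hamSum_cut_cherry hn (mem_compl.2 hp) (by simpa using hi) (by simpa using hj) hij,
    hamSum_edge hn hip, hamSum_cherry hn hip.symm hpq hiq,
    hamSum_twoEdges hn hip hij hiq hjp.symm hpq hjq, hamSum_cherry hn hip hij hjp.symm, hcard]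
  ring

theorem hamSum_cut_quad_relabel {π : Equiv.Perm (Fin n)} (hn : 4 ≤ n)
    (hU : ∀ s, π s ∈ U ↔ s ∈ U) (M : (Fin n → Fin n → ℝ) → ℝ)
    (hπ : ∀ y, IsCycleAdj y →
      quadValue p i q j (fun s t => y (π s) (π t)) = -quadValue p i q j y) :
    hamSum n (fun y => (cutValue U y - 2) * quadValue p i q j y
        * M (fun s t => y (π s) (π t))) =
      -hamSum n (fun y => (cutValue U y - 2) * quadValue p i q j y * M y) := by
  rw [← hamSum_relabel π (fun y => (cutValue U y - 2) * quadValue p i q j y * M y), hamSum, hamSum,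
    ← sum_neg_distrib]
  refine sum_congr rfl fun x hx => ?_
  rw [cutValue_relabel hU, hπ _ (isCycleAdj_xval hn hx)]
  ring

theorem swap_mem_iff {a b : Fin n} (h : a ∈ U ↔ b ∈ U) (s : Fin n) :
    Equiv.swap a b s ∈ U ↔ s ∈ U := by
  rw [Equiv.swap_apply_def]
  split_ifs with h1 h2
  · rw [h1, h]
  · rw [h2, h]
  · rfl

theorem quadValue_swap_outer (hip : i ≠ p) (hiq : i ≠ q) (hjp : j ≠ p) (hjq : j ≠ q)
    {y : Fin n → Fin n → ℝ} (hy : IsCycleAdj y) :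
    quadValue p i q j (fun s t => y (Equiv.swap p q s) (Equiv.swap p q t)) =
      -quadValue p i q j y := by
  simp only [quadValue, Equiv.swap_apply_left, Equiv.swap_apply_right,
    Equiv.swap_apply_of_ne_of_ne hip hiq, Equiv.swap_apply_of_ne_of_ne hjp hjq]
  linear_combination hy.symm q i - hy.symm i p + hy.symm p j - hy.symm j q

theorem quadValue_swap_inner (hip : i ≠ p) (hiq : i ≠ q) (hjp : j ≠ p) (hjq : j ≠ q)
    {y : Fin n → Fin n → ℝ} (hy : IsCycleAdj y) :
    quadValue p i q j (fun s t => y (Equiv.swap i j s) (Equiv.swap i j t)) =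
      -quadValue p i q j y := by
  simp only [quadValue, Equiv.swap_apply_left, Equiv.swap_apply_right,
    Equiv.swap_apply_of_ne_of_ne hip.symm hjp.symm, Equiv.swap_apply_of_ne_of_ne hiq.symm hjq.symm]
  linear_combination hy.symm p j - hy.symm j q + hy.symm q i - hy.symm i p

theorem hamSum_cut_quad_const (hn : 6 ≤ n) (hi : i ∈ U) (hj : j ∈ U) (hp : p ∉ U)
    (hq : q ∉ U) :
    hamSum n (fun y => (cutValue U y - 2) * quadValue p i q j y) = 0 := by
  have hip : i ≠ p := fun h => hp (h ▸ hi)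
  have hiq : i ≠ q := fun h => hq (h ▸ hi)
  have hjp : j ≠ p := fun h => hp (h ▸ hj)
  have hjq : j ≠ q := fun h => hq (h ▸ hj)
  have h := hamSum_cut_quad_relabel (by omega) (swap_mem_iff (iff_of_false hp hq)) (fun _ => 1)
    (fun y hy => quadValue_swap_outer hip hiq hjp hjq hy)
  simp only [mul_one] at h
  linarith

theorem hamSum_cut_quad_coord (hn : 6 ≤ n) (hi : i ∈ U) (hj : j ∈ U) (hij : i ≠ j) (hp : p ∉ U)
    (hq : q ∉ U) (hpq : p ≠ q) (e : EdgeIdx n) :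
    ∑ x ∈ hamX n, (cutValue U (xval x) - 2) * quadValue p i q j (xval x) * x e =
      2 * ((#U : ℝ) * ((n : ℝ) - 3) * ((n : ℝ) - #U) - ((n : ℝ) - 2) ^ 2) * pathCount n
        * quadCoef p i q j e := by
  have hip : i ≠ p := fun h => hp (h ▸ hi)
  have hiq : i ≠ q := fun h => hq (h ▸ hi)
  have hjp : j ≠ p := fun h => hp (h ▸ hj)
  have hjq : j ≠ q := fun h => hq (h ▸ hj)
  have hbase := hamSum_cut_quad_edge hn hi hj hij hp hq hpq
  generalize 2 * ((#U : ℝ) * ((n : ℝ) - 3) * ((n : ℝ) - #U) - ((n : ℝ) - 2) ^ 2) * pathCount n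
    = K at hbase ⊢
  set F : Fin n → Fin n → ℝ := fun a b =>
    hamSum n (fun y => (cutValue U y - 2) * quadValue p i q j y * y a b) with hF
  have hsymm : ∀ a b, F a b = F b a := fun a b =>
    hamSum_congr (by omega) fun y hy => by rw [hy.symm a b]
  have houter : ∀ a b, F (Equiv.swap p q a) (Equiv.swap p q b) = -F a b := fun a b =>
    hamSum_cut_quad_relabel (by omega) (swap_mem_iff (iff_of_false hp hq)) (fun y => y a b)
      (fun y hy => quadValue_swap_outer hip hiq hjp hjq hy)
  have hinner : ∀ a b, F (Equiv.swap i j a) (Equiv.swap i j b) = -F a b := fun a b =>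
    hamSum_cut_quad_relabel (by omega) (swap_mem_iff (iff_of_true hi hj)) (fun y => y a b)
      (fun y hy => quadValue_swap_inner hip hiq hjp hjq hy)
  have hFip : F i p = K := hbase
  have hFiq : F i q = -K := by
    have h := houter i p
    rwa [Equiv.swap_apply_of_ne_of_ne hip hiq, Equiv.swap_apply_left, hFip] at h
  have hFjp : F j p = -K := by
    have h := hinner i p
    rwa [Equiv.swap_apply_left, Equiv.swap_apply_of_ne_of_ne hip.symm hjp.symm, hFip] at h
  have hFjq : F j q = K := by
    have h := hinner i q
    rwa [Equiv.swap_apply_left, Equiv.swap_apply_of_ne_of_ne hiq.symm hjq.symm, hFiq,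
      neg_neg] at h
  obtain ⟨e, he⟩ := e
  induction e using Sym2.ind with
  | _ a b =>
  have hab : a ≠ b := by simpa using he
  have hsum : ∑ x ∈ hamX n, (cutValue U (xval x) - 2) * quadValue p i q j (xval x)
      * x ⟨s(a, b), he⟩ = F a b :=
    sum_congr rfl fun x _ => by simp only [xval, dif_neg hab]
  rw [hsum]
  clear_value F
  by_cases h1 : a ≠ p ∧ a ≠ q ∧ b ≠ p ∧ b ≠ q
  · obtain ⟨h1, h2, h3, h4⟩ := h1
    have h := houter a b
    rw [Equiv.swap_apply_of_ne_of_ne h1 h2, Equiv.swap_apply_of_ne_of_ne h3 h4] at h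
    have h0 : F a b = 0 := by linarith
    simp [quadCoef, h0, h1, h2, h3, h4]
  by_cases h2 : a ≠ i ∧ a ≠ j ∧ b ≠ i ∧ b ≠ j
  · obtain ⟨h1, h2, h3, h4⟩ := h2
    have h := hinner a b
    rw [Equiv.swap_apply_of_ne_of_ne h1 h2, Equiv.swap_apply_of_ne_of_ne h3 h4] at h
    have h0 : F a b = 0 := by linarith
    simp [quadCoef, h0, h1, h2, h3, h4]
  have hcases : ((a = i ∨ a = j) ∧ (b = p ∨ b = q)) ∨ ((a = p ∨ a = q) ∧ (b = i ∨ b = j)) := by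
    clear * - h1 h2 hip hiq hjp hjq
    grind
  rcases hcases with ⟨h | h, h' | h'⟩ | ⟨h | h, h' | h'⟩ <;>
    simp [quadCoef, h, h', hFip, hFiq, hFjp, hFjq, hsymm p i, hsymm p j, hsymm q i, hsymm q j,
      hip, hiq, hjp, hjq, hij, hpq, hip.symm, hiq.symm, hjp.symm, hjq.symm, hij.symm, hpq.symm]

end CutMoments

/-- **eigenvector of `A_U`, mixed kind.**  Let `n ≥ 6`,
`U ⊂ {1, …, n}`, `|U| = m`, `3 ≤ m ≤ n/2`, let `i, j ∈ U` be distinct and let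
`p, q ∉ U` be distinct.  The degree-1 polynomial
`u(x) = x_{ip} - x_{iq} + x_{jq} - x_{jp}` (whose coefficient vector is
`quadCoef p i q j`, since `x_{pi} - x_{iq} + x_{qj} - x_{jp} = u(x)`) satisfies,
for every degree-≤1 polynomial `w(x) = w₀ + Σ_e w_e x_e`,
`(1/|X|) Σ_{x∈X} h_U(x) u(x) w(x)
  = (2(m(n-3)(n-m) - (n-2)²)/((n-2)(n-3)(m-1)(n-m-1))) ⟨u, w⟩`;
i.e. `u` is an eigenvector of the matrix of `q_{h_U}` with eigenvalue
`2(m(n-3)(n-m) - (n-2)²)/((n-2)(n-3)(m-1)(n-m-1))`. -/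
theorem eigenvector_of_subtour_form_mixed
    (n m : ℕ) (hn : 6 ≤ n) (U : Finset (Fin n)) (hUcard : U.card = m)
    (hm3 : 3 ≤ m) (hmn : 2 * m ≤ n)
    (i j : Fin n) (hiU : i ∈ U) (hjU : j ∈ U) (hij : i ≠ j)
    (p q : Fin n) (hpU : p ∉ U) (hqU : q ∉ U) (hpq : p ≠ q)
    (w0 : ℝ) (w : EdgeIdx n → ℝ) :
    ((hamX n).card : ℝ)⁻¹ * ∑ x ∈ hamX n,
        hU U x * (∑ e : EdgeIdx n, quadCoef p i q j e * x e) *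
          (w0 + ∑ e : EdgeIdx n, w e * x e)
      = (2 * ((m : ℝ) * ((n : ℝ) - 3) * ((n : ℝ) - (m : ℝ)) - ((n : ℝ) - 2) ^ 2) /
            (((n : ℝ) - 2) * ((n : ℝ) - 3) * ((m : ℝ) - 1) * ((n : ℝ) - (m : ℝ) - 1))) *
          ∑ e : EdgeIdx n, quadCoef p i q j e * w e := by
  subst hUcard
  have hip : i ≠ p := fun h => hpU (h ▸ hiU)
  have hiq : i ≠ q := fun h => hqU (h ▸ hiU)
  have hjp : j ≠ p := fun h => hpU (h ▸ hjU)
  have hjq : j ≠ q := fun h => hqU (h ▸ hjU)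
  have hsum : ∑ x ∈ hamX n, hU U x * (∑ e : EdgeIdx n, quadCoef p i q j e * x e) *
      (w0 + ∑ e : EdgeIdx n, w e * x e) =
      (((n : ℝ) - 1) / (2 * ((#U : ℝ) * ((n : ℝ) - #U) + 1 - n))) *
        (2 * ((#U : ℝ) * ((n : ℝ) - 3) * ((n : ℝ) - #U) - ((n : ℝ) - 2) ^ 2) * pathCount n *
          ∑ e : EdgeIdx n, quadCoef p i q j e * w e) := by
    have hconst := hamSum_cut_quad_const hn hiU hjU hpU hqU
    have hlin : ∑ x ∈ hamX n, (cutValue U (xval x) - 2) * quadValue p i q j (xval x) *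
        (w0 + ∑ e : EdgeIdx n, w e * x e) =
        w0 * hamSum n (fun y => (cutValue U y - 2) * quadValue p i q j y) +
          ∑ e : EdgeIdx n, w e * ∑ x ∈ hamX n,
            (cutValue U (xval x) - 2) * quadValue p i q j (xval x) * x e := by
      simp only [hamSum, mul_sum]
      rw [sum_comm, ← sum_add_distrib]
      refine sum_congr rfl fun x _ => ?_
      rw [mul_add, mul_sum]
      congr 1
      · ring
      · exact sum_congr rfl fun e _ => by ring
    rw [hconst, mul_zero, zero_add] at hlin
    simp only [hamSum_cut_quad_coord hn hiU hjU hij hpU hqU hpq] at hlin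
    rw [mul_sum, sum_congr rfl (g := fun e => w e * _) fun e _ => by
      rw [mul_comm (quadCoef p i q j e), mul_left_comm], ← hlin, mul_sum]
    refine sum_congr rfl fun x _ => ?_
    rw [sum_quadCoef_mul hip.symm hiq hjq.symm hjp, hU, quadValue, cutValue]
    ring
  have hX : (#(hamX n) : ℝ) ≠ 0 := by
    have : (hamX n).Nonempty := ⟨cycleVec n 1, mem_image_of_mem _ (mem_univ _)⟩
    exact_mod_cast this.card_ne_zero
  have hm3' : (3 : ℝ) ≤ #U := by exact_mod_cast hm3
  have hmn' : 2 * (#U : ℝ) ≤ n := by exact_mod_cast hmn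
  have h1 : (n : ℝ) - 1 ≠ 0 := by linarith
  have h2 : (n : ℝ) - 2 ≠ 0 := by linarith
  have h3 : (n : ℝ) - 3 ≠ 0 := by linarith
  have h4 : (#U : ℝ) - 1 ≠ 0 := by linarith
  have h5 : (n : ℝ) - #U - 1 ≠ 0 := by linarith
  have h6 : (#U : ℝ) * ((n : ℝ) - #U) + 1 - n = ((#U : ℝ) - 1) * ((n : ℝ) - #U - 1) := by ring
  rw [hsum, h6, pathCount]
  field_simp
end
end
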